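/- arXiv:1901.10043 — 2 statements merged into one kernel-verified Lean document; each statement's English description precedes it below -/
import Mathlib

section
/- Let (R, 𝔪) be a regular local ring of Krull dimension 2. For any two elements μ, ν ∈ 𝒱 there exists ρ ∈ 𝒱 such that ρ ≤ μ, ρ ≤ ν, and every σ ∈ 𝒱 with σ ≤ μ and σ ≤ ν satisfies σ ≤ ρ; that is, the infimum of μ and ν exists in the poset 𝒱. -/
open IsLocalRing

/-- A centered valuation on a local ring `(R, 𝔪)`: a function `ν : R → ℝ ∪ {∞}`
(modelled as `EReal`, with all values `≥ 0`, hence never `⊥`) satisfying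
`ν(fg) = ν f + ν g`, `ν(f+g) ≥ min (ν f) (ν g)`, `ν 1 = 0`, `ν f ≥ 0` for all `f`,
`ν f > 0` for `f ∈ 𝔪`, and `ν f < ∞` for some `f ∈ 𝔪`. -/
structure CenteredValn (R : Type*) [CommRing R] [IsLocalRing R] where
  v : R → EReal
  map_mul : ∀ f g : R, v (f * g) = v f + v g
  add_ge : ∀ f g : R, min (v f) (v g) ≤ v (f + g)
  map_one : v 1 = 0
  nonneg : ∀ f : R, 0 ≤ v f
  pos : ∀ f : R, f ∈ maximalIdeal R → 0 < v f
  proper : ∃ f : R, f ∈ maximalIdeal R ∧ v f ≠ ⊤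

/-- A centered valuation is normalized if `inf {ν f : f ∈ 𝔪} = 1`. -/
def CenteredValn.Normalized {R : Type*} [CommRing R] [IsLocalRing R]
    (ν : CenteredValn R) : Prop :=
  sInf {x : EReal | ∃ f ∈ maximalIdeal R, ν.v f = x} = 1

/-- The multiplicity function `f ↦ sup {i ∈ ℕ : f ∈ 𝔪^i}` (so `0 ↦ ∞`). -/
noncomputable def multVal (R : Type*) [CommRing R] [IsLocalRing R] (f : R) : EReal :=
  sSup {x : EReal | ∃ i : ℕ, f ∈ maximalIdeal R ^ i ∧ x = (i : EReal)}

section Algebra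

variable {R : Type*} [CommRing R] [IsLocalRing R]

/-- Krull intersection for quotients. -/
lemma krull_aux [IsNoetherianRing R] (J : Ideal R) (h : R)
    (H : ∀ N : ℕ, h ∈ J ⊔ maximalIdeal R ^ N) : h ∈ J := by
  have key := Ideal.iInf_pow_smul_eq_bot_of_isLocalRing (M := R ⧸ J) (maximalIdeal R)
    (Ideal.IsPrime.ne_top')
  have : (Ideal.Quotient.mk J h) ∈ (⨅ i : ℕ, maximalIdeal R ^ i • (⊤ : Submodule R (R ⧸ J))) := by
    rw [Submodule.mem_iInf]
    intro N
    obtain ⟨a, ha, b, hb, rfl⟩ := Submodule.mem_sup.1 (H N)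
    rw [map_add, Ideal.Quotient.eq_zero_iff_mem.2 ha, zero_add]
    have h2 : b • (1 : R ⧸ J) ∈ maximalIdeal R ^ N • (⊤ : Submodule R (R ⧸ J)) :=
      Submodule.smul_mem_smul hb trivial
    rwa [Algebra.smul_def, mul_one] at h2
  rw [key, Submodule.mem_bot] at this
  exact Ideal.Quotient.eq_zero_iff_mem.1 this

/-- `𝔪^n + (x)` is generated by `x` and `y^n`. -/
lemma mem_aux {x y : R} (hm : maximalIdeal R = Ideal.span {x, y}) (n : ℕ) (s : R)
    (hs : s ∈ Ideal.span {x} ⊔ maximalIdeal R ^ n) : ∃ a t, s = a * y ^ n + x * t := by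
  have hle : ∀ b ∈ maximalIdeal R ^ n, ∃ a t, b = a * y ^ n + x * t := by
    clear hs
    induction n with
    | zero => intro b _; exact ⟨b, 0, by simp⟩
    | succ n ih =>
      intro b hb
      rw [pow_succ] at hb
      refine Submodule.mul_induction_on hb ?_ ?_
      · intro c hc d hd
        obtain ⟨a, t, rfl⟩ := ih c hc
        rw [hm, Ideal.mem_span_pair] at hd
        obtain ⟨e, f, rfl⟩ := hd
        exact ⟨a * f, t * (e * x + f * y) + a * y ^ n * e, by ring⟩
      · rintro c d ⟨a, t, rfl⟩ ⟨a', t', rfl⟩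
        exact ⟨a + a', t + t', by ring⟩
  obtain ⟨a, ha, b, hb, rfl⟩ := Submodule.mem_sup.1 hs
  obtain ⟨t, rfl⟩ := Ideal.mem_span_singleton'.1 ha
  obtain ⟨c, t', rfl⟩ := hle b hb
  exact ⟨c, t + t', by ring⟩

lemma x_mem {x y : R} (hm : maximalIdeal R = Ideal.span {x, y}) : x ∈ maximalIdeal R :=
  hm ▸ Ideal.subset_span (by simp)

lemma y_mem {x y : R} (hm : maximalIdeal R = Ideal.span {x, y}) : y ∈ maximalIdeal R :=
  hm ▸ Ideal.subset_span (by simp)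

lemma mem_aux' {x y : R} (hm : maximalIdeal R = Ideal.span {x, y}) (n : ℕ) (a t : R) :
    a * y ^ n + x * t ∈ Ideal.span {x} ⊔ maximalIdeal R ^ n := by
  refine Ideal.add_mem _ (Ideal.mem_sup_right ?_) (Ideal.mem_sup_left ?_)
  · exact Ideal.mul_mem_left _ _ (Ideal.pow_mem_pow (y_mem hm) n)
  · exact Ideal.mul_mem_right _ _ (Ideal.mem_span_singleton_self x)

lemma unit_aux {x y : R} (hm : maximalIdeal R = Ideal.span {x, y}) (n : ℕ) (s : R)
    (hs : s ∈ Ideal.span {x} ⊔ maximalIdeal R ^ n)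
    (hs' : s ∉ Ideal.span {x} ⊔ maximalIdeal R ^ (n + 1)) :
    ∃ a t, IsUnit a ∧ s = a * y ^ n + x * t := by
  obtain ⟨a, t, rfl⟩ := mem_aux hm n s hs
  refine ⟨a, t, ?_, rfl⟩
  by_contra hu
  have ha : a ∈ maximalIdeal R := hu
  apply hs'
  refine Ideal.add_mem _ (Ideal.mem_sup_right ?_) (Ideal.mem_sup_left ?_)
  · rw [pow_succ']
    exact Ideal.mul_mem_mul ha (Ideal.pow_mem_pow (y_mem hm) n)
  · exact Ideal.mul_mem_right _ _ (Ideal.mem_span_singleton_self x)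

lemma div_aux {x y : R} (hm : maximalIdeal R = Ideal.span {x, y}) (n : ℕ) (φ s : R)
    (hφ : φ ∈ Ideal.span {x} ⊔ maximalIdeal R ^ n)
    (hφ' : φ ∉ Ideal.span {x} ⊔ maximalIdeal R ^ (n + 1))
    (hs : s ∈ Ideal.span {x} ⊔ maximalIdeal R ^ n) :
    ∃ q s', s = q * φ + x * s' := by
  obtain ⟨u, t, hu, rfl⟩ := unit_aux hm n φ hφ hφ'
  obtain ⟨a, t', rfl⟩ := mem_aux hm n s hs
  obtain ⟨w, hw⟩ := hu.exists_left_inv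
  refine ⟨a * w, t' - a * w * t, ?_⟩
  linear_combination (-a * y ^ n) * hw

/-- last index of a decreasing filtration -/
lemma exists_last (p : ℕ → Prop) (h0 : p 0) (h : ∃ n, ¬ p n) : ∃ n, p n ∧ ¬ p (n + 1) := by
  by_contra hc
  push Not at hc
  obtain ⟨n, hn⟩ := h
  exact hn (Nat.rec h0 hc n)

lemma height_aux (hdim : ringKrullDim R = 2) : ¬ (maximalIdeal R).height ≤ 1 := by
  intro h
  have h2 := IsLocalRing.maximalIdeal_height_eq_ringKrullDim (R := R)
  rw [hdim] at h2
  have h3 : ((maximalIdeal R).height : WithBot ℕ∞) ≤ ((1 : ℕ∞) : WithBot ℕ∞) :=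
    WithBot.coe_le_coe.2 h
  rw [h2] at h3
  have h4 : ((2 : ℕ∞) : WithBot ℕ∞) ≤ ((1 : ℕ∞) : WithBot ℕ∞) := h3
  exact absurd (WithBot.coe_le_coe.1 h4) (by decide)

variable [IsNoetherianRing R]

lemma y_pow_notMem {x y : R} (hdim : ringKrullDim R = 2)
    (hm : maximalIdeal R = Ideal.span {x, y}) (k : ℕ) : y ^ k ∉ Ideal.span {x} := by
  intro hk
  have hmin : maximalIdeal R ∈ (Ideal.span {x}).minimalPrimes := by
    refine ⟨⟨inferInstance, ?_⟩, ?_⟩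
    · rw [Ideal.span_singleton_le_iff_mem]; exact x_mem hm
    · rintro p ⟨hp, hxp⟩ -
      rw [hm, Ideal.span_le]
      rintro z (rfl | rfl)
      · exact hxp (Ideal.mem_span_singleton_self _)
      · exact hp.mem_of_pow_mem k (hxp hk)
  have h1 := Ideal.height_le_one_of_isPrincipal_of_mem_minimalPrimes _ _ hmin
  exact height_aux hdim h1

lemma y_pow_cancel {x y : R} (hdim : ringKrullDim R = 2)
    (hm : maximalIdeal R = Ideal.span {x, y}) (k : ℕ) (b : R)
    (hb : b * y ^ k ∈ Ideal.span {x}) : b ∈ Ideal.span {x} := by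
  by_contra hbx
  have : ∃ n, b ∉ Ideal.span {x} ⊔ maximalIdeal R ^ n := by
    by_contra hc
    push Not at hc
    exact hbx (krull_aux _ _ hc)
  obtain ⟨n, h1, h2⟩ := exists_last (fun n => b ∈ Ideal.span {x} ⊔ maximalIdeal R ^ n)
    (by simp) this
  obtain ⟨u, t, hu, rfl⟩ := unit_aux hm n b h1 h2
  obtain ⟨w, hw⟩ := hu.exists_left_inv
  obtain ⟨c, hc⟩ := Ideal.mem_span_singleton'.1 hb
  apply y_pow_notMem hdim hm (n + k)
  rw [Ideal.mem_span_singleton']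
  exact ⟨w * c - w * t * y ^ k, by linear_combination w * hc + y ^ (n + k) * hw⟩

variable [IsDomain R]

lemma x_colon {x y : R} (hdim : ringKrullDim R = 2)
    (hm : maximalIdeal R = Ideal.span {x, y}) (n : ℕ) (h : R)
    (hh : x * h ∈ maximalIdeal R ^ (n + 1)) : h ∈ maximalIdeal R ^ n := by
  have hx0 : x ≠ 0 := by
    rintro rfl
    have := y_pow_cancel hdim hm
    have h2 : (maximalIdeal R).height ≤ 1 := by
      refine (Ideal.height_le_one_of_isPrincipal_of_mem_minimalPrimes (Ideal.span {y}) _ ?_)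
      have : maximalIdeal R = Ideal.span {y} := by rw [hm, Ideal.span_insert_zero]
      rw [← this, Ideal.minimalPrimes_eq_subsingleton_self]
      rfl
    exact height_aux hdim h2
  have hdec : ∀ n : ℕ, ∀ s ∈ maximalIdeal R ^ n, ∃ c, ∃ d ∈ maximalIdeal R ^ (n - 1),
      s = x * d + c * y ^ n := by
    intro n
    induction n with
    | zero => intro s _; exact ⟨s, 0, by simp, by simp⟩
    | succ n ih =>
      intro s hs
      rw [pow_succ] at hs
      refine Submodule.mul_induction_on hs ?_ ?_
      · intro a ha b hb
        obtain ⟨c, d, hd, hcd⟩ := ih a ha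
        rw [hm, Ideal.mem_span_pair] at hb
        obtain ⟨e, f, rfl⟩ := hb
        refine ⟨c * f, a * e + d * f * y, ?_, by rw [hcd]; ring⟩
        refine Ideal.add_mem _ (Ideal.mul_mem_right _ _ ha) ?_
        rcases n with _ | n
        · simp
        · have : d * y ∈ maximalIdeal R ^ (n + 1) := by
            rw [pow_succ]; exact Ideal.mul_mem_mul hd (y_mem hm)
          have h := Ideal.mul_mem_right f _ this
          simpa [mul_assoc, mul_comm, mul_left_comm] using h
      · rintro a b ⟨c, d, hd, rfl⟩ ⟨c', d', hd', rfl⟩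
        exact ⟨c + c', d + d', Ideal.add_mem _ hd hd', by ring⟩
  obtain ⟨c, d, hd, hcd⟩ := hdec _ _ hh
  have hc : c ∈ Ideal.span {x} := by
    apply y_pow_cancel hdim hm (n + 1)
    rw [Ideal.mem_span_singleton']
    exact ⟨h - d, by linear_combination hcd⟩
  obtain ⟨e, rfl⟩ := Ideal.mem_span_singleton'.1 hc
  have : h = d + e * y ^ (n + 1) := by
    apply mul_left_cancel₀ hx0
    linear_combination hcd
  rw [this]
  refine Ideal.add_mem _ (by simpa using hd) (Ideal.mul_mem_left _ _ ?_)
  exact Ideal.pow_le_pow_right (Nat.le_succ n) (Ideal.pow_mem_pow (y_mem hm) _)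

lemma ord_mul {x y : R} (hdim : ringKrullDim R = 2)
    (hm : maximalIdeal R = Ideal.span {x, y}) (N : ℕ) : ∀ (n p : ℕ) (_ : n + p = N) (f g : R),
    f ∈ maximalIdeal R ^ n → f ∉ maximalIdeal R ^ (n + 1) →
    g ∈ maximalIdeal R ^ p → g ∉ maximalIdeal R ^ (p + 1) →
    f * g ∉ maximalIdeal R ^ (n + p + 1) := by
  induction N with
  | zero =>
    intro n p hnp f g _ hf' _ hg' hfg
    obtain rfl : n = 0 := by omega
    obtain rfl : p = 0 := by omega
    simp only [zero_add, pow_one, add_zero] at *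
    rcases (Ideal.IsPrime.mem_or_mem inferInstance hfg) with h | h
    exacts [hf' h, hg' h]
  | succ N ih =>
    -- the inductive step when `f` lies in `𝔪^(n+1) + (x)`
    have step : ∀ (n p : ℕ) (_ : n + p = N + 1) (f g : R),
        f ∈ maximalIdeal R ^ n → f ∉ maximalIdeal R ^ (n + 1) →
        g ∈ maximalIdeal R ^ p → g ∉ maximalIdeal R ^ (p + 1) →
        f ∈ Ideal.span {x} ⊔ maximalIdeal R ^ (n + 1) →
        f * g ∉ maximalIdeal R ^ (n + p + 1) := by
      intro n p hnp f g hf hf' hg hg' hfx hfg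
      obtain ⟨a, ha, f1, hf1, rfl⟩ := Submodule.mem_sup.1 hfx
      obtain ⟨f2, rfl⟩ := Ideal.mem_span_singleton'.1 ha
      rcases n with _ | n
      · apply hf'
        refine Ideal.add_mem _ (Ideal.mul_mem_left _ _ ?_) hf1
        simpa using x_mem hm
      have h1 : x * f2 ∈ maximalIdeal R ^ (n + 1) := by
        have := Ideal.sub_mem _ hf (Ideal.pow_le_pow_right (Nat.le_succ _) hf1)
        rwa [add_sub_cancel_right, mul_comm] at this
      have h2 := x_colon hdim hm n f2 h1
      have h3 : f2 ∉ maximalIdeal R ^ (n + 1) := by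
        intro h
        apply hf'
        refine Ideal.add_mem _ ?_ hf1
        rw [pow_succ]
        exact Ideal.mul_mem_mul h (x_mem hm)
      apply ih n p (by omega) f2 g h2 h3 hg hg'
      apply x_colon hdim hm
      have h4 : f1 * g ∈ maximalIdeal R ^ (n + 1 + p + 1) := by
        have := Ideal.mul_mem_mul hf1 hg
        rw [← pow_add] at this
        convert! this using 2
        omega
      have h5 := Ideal.sub_mem _ hfg h4
      have e : (f2 * x + f1) * g - f1 * g = x * (f2 * g) := by ring
      rw [e] at h5
      convert! h5 using 2
      omega
    intro n p hnp f g hf hf' hg hg' hfg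
    by_cases hfx : f ∈ Ideal.span {x} ⊔ maximalIdeal R ^ (n + 1)
    · exact step n p hnp f g hf hf' hg hg' hfx hfg
    by_cases hgx : g ∈ Ideal.span {x} ⊔ maximalIdeal R ^ (p + 1)
    · refine step p n (by omega) g f hg hg' hf hf' hgx ?_
      rwa [mul_comm, add_comm p n]
    obtain ⟨u, t, hu, rfl⟩ := unit_aux hm n f (Ideal.mem_sup_right hf) hfx
    obtain ⟨u', t', hu', rfl⟩ := unit_aux hm p g (Ideal.mem_sup_right hg) hgx
    obtain ⟨a, s, has⟩ := mem_aux hm _ _ (Ideal.mem_sup_right hfg)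
    have hunit : IsUnit (u * u' - a * y) := by
      by_contra hc
      have hc' : u * u' - a * y ∈ maximalIdeal R := hc
      have h := Ideal.add_mem _ hc' (Ideal.mul_mem_left _ a (y_mem hm))
      rw [sub_add_cancel] at h
      exact h (hu.mul hu')
    obtain ⟨w, hw⟩ := hunit.exists_left_inv
    apply y_pow_notMem hdim hm (n + p)
    rw [Ideal.mem_span_singleton']
    refine ⟨w * (s - t * (u' * y ^ p + x * t') - u * y ^ n * t'), ?_⟩
    linear_combination -w * has + y ^ (n + p) * hw

lemma multVal_eq {f : R} {n : ℕ} (h : f ∈ maximalIdeal R ^ n)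
    (h' : f ∉ maximalIdeal R ^ (n + 1)) : multVal R f = n := by
  apply le_antisymm
  · apply sSup_le
    rintro _ ⟨i, hi, rfl⟩
    have : i ≤ n := by
      by_contra hc
      exact h' (Ideal.pow_le_pow_right (by omega) hi)
    exact_mod_cast this
  · exact le_sSup ⟨n, h, rfl⟩

lemma le_multVal {f : R} {n : ℕ} (h : f ∈ maximalIdeal R ^ n) : (n : EReal) ≤ multVal R f :=
  le_sSup ⟨n, h, rfl⟩

lemma multVal_zero : multVal R 0 = ⊤ := by
  rw [EReal.eq_top_iff_forall_lt]
  intro y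
  obtain ⟨n, hn⟩ := exists_nat_gt y
  refine lt_of_lt_of_le ?_ (le_multVal (n := n) (Ideal.zero_mem _))
  exact_mod_cast hn

lemma exists_ord {f : R} (hf : f ≠ 0) :
    ∃ n, f ∈ maximalIdeal R ^ n ∧ f ∉ maximalIdeal R ^ (n + 1) := by
  apply exists_last (fun n => f ∈ maximalIdeal R ^ n) (by simp)
  by_contra hc
  push Not at hc
  apply hf
  have := krull_aux (⊥ : Ideal R) f (by simpa using hc)
  simpa using this

lemma multVal_nonneg (f : R) : 0 ≤ multVal R f := by
  have := le_multVal (R := R) (f := f) (n := 0) (by simp)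
  simpa using this

lemma multVal_add (f g : R) : min (multVal R f) (multVal R g) ≤ multVal R (f + g) := by
  by_contra hc
  push Not at hc
  rw [lt_min_iff] at hc
  obtain ⟨h1, h2⟩ := hc
  obtain ⟨_, ⟨i, hi, rfl⟩, h1⟩ := lt_sSup_iff.1 h1
  obtain ⟨_, ⟨j, hj, rfl⟩, h2⟩ := lt_sSup_iff.1 h2
  have : f + g ∈ maximalIdeal R ^ (min i j) :=
    Ideal.add_mem _ (Ideal.pow_le_pow_right (min_le_left _ _) hi)
      (Ideal.pow_le_pow_right (min_le_right _ _) hj)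
  have h3 := le_multVal this
  rcases min_choice i j with h | h <;> rw [h] at h3
  · exact absurd h3 (not_le.2 h1)
  · exact absurd h3 (not_le.2 h2)

lemma multVal_mul {x y : R} (hdim : ringKrullDim R = 2)
    (hm : maximalIdeal R = Ideal.span {x, y}) (f g : R) :
    multVal R (f * g) = multVal R f + multVal R g := by
  by_cases hf : f = 0
  · subst hf
    rw [zero_mul, multVal_zero, EReal.top_add_of_ne_bot]
    exact (lt_of_lt_of_le EReal.bot_lt_zero (multVal_nonneg g)).ne'
  by_cases hg : g = 0
  · subst hg
    rw [mul_zero, multVal_zero, EReal.add_top_of_ne_bot]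
    exact (lt_of_lt_of_le EReal.bot_lt_zero (multVal_nonneg f)).ne'
  obtain ⟨n, h1, h2⟩ := exists_ord hf
  obtain ⟨p, h3, h4⟩ := exists_ord hg
  rw [multVal_eq h1 h2, multVal_eq h3 h4, multVal_eq (n := n + p) _
    (ord_mul hdim hm _ n p rfl f g h1 h2 h3 h4)]
  · push_cast; rfl
  · rw [pow_add]; exact Ideal.mul_mem_mul h1 h3

end Algebra

section Valuations

variable {R : Type*} [CommRing R] [IsLocalRing R]

namespace CenteredValn

variable (σ τ μ ν : CenteredValn R)

lemma ne_bot (f : R) : σ.v f ≠ ⊥ :=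
  (lt_of_lt_of_le EReal.bot_lt_zero (σ.nonneg f)).ne'

lemma map_unit {u : R} (hu : IsUnit u) : σ.v u = 0 := by
  obtain ⟨w, hw⟩ := hu.exists_left_inv
  have h := σ.map_mul w u
  rw [hw, σ.map_one] at h
  refine le_antisymm ?_ (σ.nonneg u)
  rw [h]
  exact le_add_of_nonneg_left (σ.nonneg w)

lemma map_neg (f : R) : σ.v (-f) = σ.v f := by
  rw [← neg_one_mul, σ.map_mul, σ.map_unit isUnit_one.neg, zero_add]

lemma map_zero : σ.v 0 = ⊤ := by
  by_contra h
  obtain ⟨f, hf, -⟩ := σ.proper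
  have h1 := σ.map_mul 0 f
  rw [zero_mul] at h1
  have h2 := σ.pos f hf
  have h3 : σ.v 0 + 0 < σ.v 0 + σ.v f := by
    have := EReal.add_lt_add_of_lt_of_le h2 (le_refl (σ.v 0)) (σ.ne_bot 0) h
    rwa [add_comm, add_comm (σ.v f)] at this
  rw [add_zero, ← h1] at h3
  exact lt_irrefl _ h3

lemma sub_ge (f g : R) : min (σ.v f) (σ.v g) ≤ σ.v (f - g) := by
  rw [sub_eq_add_neg, ← σ.map_neg g]
  exact σ.add_ge _ _

lemma one_le {σ : CenteredValn R} (hσ : σ.Normalized) {f : R} (hf : f ∈ maximalIdeal R) :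
    1 ≤ σ.v f := by
  have h : sInf {x : EReal | ∃ f ∈ maximalIdeal R, σ.v f = x} = 1 := hσ
  rw [← h]
  exact sInf_le ⟨f, hf, rfl⟩

lemma normalized_of {σ μ : CenteredValn R} (hμ : μ.Normalized) (h : ∀ f, σ.v f ≤ μ.v f)
    (h1 : ∀ f ∈ maximalIdeal R, 1 ≤ σ.v f) : σ.Normalized := by
  have hμ' : sInf {x : EReal | ∃ f ∈ maximalIdeal R, μ.v f = x} = 1 := hμ
  apply le_antisymm
  · rw [← hμ']
    apply le_sInf
    rintro _ ⟨f, hf, rfl⟩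
    have h2 : sInf {x : EReal | ∃ f ∈ maximalIdeal R, σ.v f = x} ≤ σ.v f :=
      sInf_le ⟨f, hf, rfl⟩
    exact h2.trans (h f)
  · apply le_sInf
    rintro _ ⟨f, hf, rfl⟩
    exact h1 f hf

lemma exists_param {μ : CenteredValn R} (hμ : μ.Normalized)
    (hreg : ∃ x y : R, maximalIdeal R = Ideal.span {x, y}) :
    ∃ x y : R, maximalIdeal R = Ideal.span {x, y} ∧ μ.v x = 1 := by
  obtain ⟨x, y, hm⟩ := hreg
  have hμ' : sInf {x : EReal | ∃ f ∈ maximalIdeal R, μ.v f = x} = 1 := hμ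
  have h : min (μ.v x) (μ.v y) ≤ 1 := by
    rw [← hμ']
    apply le_sInf
    rintro _ ⟨f, hf, rfl⟩
    rw [hm, Ideal.mem_span_pair] at hf
    obtain ⟨a, b, rfl⟩ := hf
    refine le_trans (min_le_min ?_ ?_) (μ.add_ge _ _)
    · rw [μ.map_mul]; exact le_add_of_nonneg_left (μ.nonneg a)
    · rw [μ.map_mul]; exact le_add_of_nonneg_left (μ.nonneg b)
  rcases min_le_iff.1 h with h | h
  · exact ⟨x, y, hm, le_antisymm h (one_le hμ (x_mem hm))⟩
  · exact ⟨y, x, by rw [hm, Set.pair_comm], le_antisymm h (one_le hμ (y_mem hm))⟩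

lemma pow_le {μ : CenteredValn R} (hμ : μ.Normalized) (n : ℕ) :
    ∀ f ∈ maximalIdeal R ^ n, (n : EReal) ≤ μ.v f := by
  induction n with
  | zero => intro f _; simpa using μ.nonneg f
  | succ n ih =>
    intro f hf
    rw [pow_succ] at hf
    refine Submodule.mul_induction_on hf ?_ ?_
    · intro a ha b hb
      rw [μ.map_mul]
      push_cast
      exact add_le_add (ih a ha) (one_le hμ hb)
    · intro a b ha hb
      exact (le_min ha hb).trans (μ.add_ge _ _)

lemma multVal_le {μ : CenteredValn R} (hμ : μ.Normalized) (f : R) : multVal R f ≤ μ.v f := by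
  apply sSup_le
  rintro _ ⟨i, hi, rfl⟩
  exact pow_le hμ i f hi

/-- The multiplicity valuation. -/
noncomputable def ordVal [IsDomain R] [IsNoetherianRing R] (hdim : ringKrullDim R = 2)
    (hreg : ∃ x y : R, maximalIdeal R = Ideal.span {x, y}) {μ : CenteredValn R}
    (hμ : μ.Normalized) : CenteredValn R where
  v := multVal R
  map_mul := by
    obtain ⟨x, y, hm⟩ := hreg
    exact multVal_mul hdim hm
  add_ge := multVal_add
  map_one := le_antisymm ((multVal_le hμ 1).trans_eq μ.map_one) (multVal_nonneg 1)
  nonneg := multVal_nonneg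
  pos := fun f hf => by
    refine lt_of_lt_of_le ?_ (le_multVal (n := 1) (by simpa using hf))
    simp
  proper := by
    obtain ⟨f, hf, h⟩ := μ.proper
    exact ⟨f, hf, ne_top_of_le_ne_top h (multVal_le hμ f)⟩

variable {σ τ μ}

/-- The key step: if `σ φ < μ φ` and `σ r = μ r` then `σ (qφ + r) = min (σ (qφ)) (σ r)`. -/
lemma key_step (hσ : ∀ f, σ.v f ≤ μ.v f) {φ q r : R} (hφ : σ.v φ < μ.v φ)
    (hr : σ.v r = μ.v r) :
    σ.v (q * φ + r) ≤ σ.v r ∧ σ.v (q * φ + r) ≤ σ.v q + σ.v φ := by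
  have h1 : σ.v (q * φ + r) ≤ σ.v r := by
    by_contra hc
    push Not at hc
    have h2 : σ.v (q * φ) ≤ σ.v r := by
      by_contra hc2
      push Not at hc2
      have := σ.sub_ge (q * φ + r) (q * φ)
      rw [add_sub_cancel_left] at this
      exact absurd this (not_le.2 (lt_min hc hc2))
    have h3 : σ.v r ≤ σ.v (q * φ) := by
      have := σ.sub_ge (q * φ + r) r
      rw [add_sub_cancel_right, min_eq_right hc.le] at this
      exact this
    have h4 : μ.v r < μ.v (q * φ) := by
      rw [← hr]
      refine lt_of_le_of_lt h3 ?_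
      rw [σ.map_mul, μ.map_mul, add_comm, add_comm (μ.v q)]
      refine EReal.add_lt_add_of_lt_of_le' hφ (hσ q) (μ.ne_bot q) ?_
      intro _ hq
      have h5 : σ.v (q * φ) < ⊤ := lt_of_le_of_lt h2 (lt_of_lt_of_le hc le_top)
      rw [σ.map_mul, hq, EReal.top_add_of_ne_bot (σ.ne_bot φ)] at h5
      exact absurd h5 (lt_irrefl _)
    have h6 : μ.v r < μ.v (q * φ + r) := by
      rw [← hr]; exact lt_of_lt_of_le hc (hσ _)
    have := μ.sub_ge (q * φ + r) (q * φ)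
    rw [add_sub_cancel_left] at this
    exact absurd this (not_le.2 (lt_min h6 h4))
  refine ⟨h1, ?_⟩
  have := σ.sub_ge (q * φ + r) r
  rw [add_sub_cancel_right, min_eq_left h1, σ.map_mul] at this
  exact this

lemma le_of_division (hσ : ∀ f, σ.v f ≤ μ.v f) {φ : R}
    (hφ : σ.v φ < μ.v φ) (hφ1 : 1 ≤ σ.v φ) (hφτ : σ.v φ ≤ τ.v φ)
    (hdiv : ∀ h : R, ∃ q r, h = q * φ + r ∧ σ.v r = μ.v r ∧ τ.v r = μ.v r) (h : R) :
    σ.v h ≤ τ.v h := by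
  have claim : ∀ (N : ℕ) (h : R), min (σ.v h) N ≤ τ.v h := by
    intro N
    induction N with
    | zero => intro h; exact (min_le_right _ _).trans (by simpa using τ.nonneg h)
    | succ N ih =>
      intro h
      obtain ⟨q, r, rfl, hr1, hr2⟩ := hdiv h
      obtain ⟨h1, h2⟩ := key_step hσ (q := q) hφ hr1
      refine le_trans (le_min ?_ ?_) (τ.add_ge _ _)
      · rw [τ.map_mul]
        refine le_trans ?_ (add_le_add (ih q) hφτ)
        rcases le_total (σ.v q) N with hN | hN
        · rw [min_eq_left hN]
          exact (min_le_left _ _).trans h2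
        · rw [min_eq_right hN]
          refine (min_le_right _ _).trans ?_
          push_cast
          exact add_le_add le_rfl hφ1
      · rw [hr2, ← hr1]
        exact (min_le_left _ _).trans h1
  by_contra hc
  push Not at hc
  have htop : τ.v h ≠ ⊤ := ne_top_of_lt hc
  obtain ⟨N, hN⟩ := exists_nat_gt (τ.v h).toReal
  have hN' : τ.v h < (N : EReal) := by
    rw [← EReal.coe_toReal htop (τ.ne_bot h)]
    exact_mod_cast hN
  exact absurd (claim N h) (not_le.2 (lt_min hc hN'))

lemma map_pow_eq {x : R} (h : σ.v x = μ.v x) (n : ℕ) : σ.v (x ^ n) = μ.v (x ^ n) := by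
  induction n with
  | zero => simp [σ.map_one, μ.map_one]
  | succ n ih => rw [pow_succ, σ.map_mul, μ.map_mul, h, ih]

/-- Below a given valuation, the normalized centered valuations are totally ordered. -/
lemma total_below [IsNoetherianRing R]
    (hreg : ∃ x y : R, maximalIdeal R = Ideal.span {x, y})
    (hσn : σ.Normalized) (hτn : τ.Normalized) (hμn : μ.Normalized)
    (hσ : ∀ f, σ.v f ≤ μ.v f) (hτ : ∀ f, τ.v f ≤ μ.v f) :
    (∀ f, σ.v f ≤ τ.v f) ∨ (∀ f, τ.v f ≤ σ.v f) := by
  obtain ⟨x, y, hm, hμx⟩ := exists_param hμn hreg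
  have hσx : σ.v x = μ.v x :=
    le_antisymm (hσ x) (hμx.trans_le (one_le hσn (x_mem hm)))
  have hτx : τ.v x = μ.v x :=
    le_antisymm (hτ x) (hμx.trans_le (one_le hτn (x_mem hm)))
  let good : R → Prop := fun f => σ.v f = μ.v f ∧ τ.v f = μ.v f
  have good_mul : ∀ a b, good a → good b → good (a * b) := by
    rintro a b ⟨h1, h2⟩ ⟨h3, h4⟩
    exact ⟨by rw [σ.map_mul, μ.map_mul, h1, h3], by rw [τ.map_mul, μ.map_mul, h2, h4]⟩
  have good_x : ∀ n, good (x ^ n) := fun n => ⟨map_pow_eq hσx n, map_pow_eq hτx n⟩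
  have good_zero : good 0 := ⟨by rw [σ.map_zero, μ.map_zero], by rw [τ.map_zero, μ.map_zero]⟩
  by_cases hall : ∀ f, good f
  · left
    intro f
    rw [(hall f).1, (hall f).2]
  push Not at hall
  obtain ⟨b, hb⟩ := hall
  -- a bad element not divisible by `x`
  have hex : ∃ n : ℕ, ∃ φ, ¬ good φ ∧ φ ∉ Ideal.span {x} ⊔ maximalIdeal R ^ (n + 1) := by
    by_contra hc
    push Not at hc
    have hdvd : ∀ φ, ¬ good φ → φ ∈ Ideal.span {x} := by
      intro φ hφ
      apply krull_aux
      intro N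
      have hle : Ideal.span {x} ⊔ maximalIdeal R ^ (N + 1) ≤ Ideal.span {x} ⊔ maximalIdeal R ^ N :=
        sup_le_sup_left (Ideal.pow_le_pow_right (Nat.le_succ N)) _
      exact hle (hc N φ hφ)
    have hpow : ∀ N : ℕ, ∃ c, b = x ^ N * c := by
      intro N
      induction N with
      | zero => exact ⟨b, by simp⟩
      | succ N ih =>
        obtain ⟨c, rfl⟩ := ih
        have hcbad : ¬ good c := fun h => hb (good_mul _ _ (good_x N) h)
        obtain ⟨d, rfl⟩ := Ideal.mem_span_singleton'.1 (hdvd c hcbad)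
        exact ⟨d, by ring⟩
    have hb0 : b ∈ (⊥ : Ideal R) := by
      apply krull_aux
      intro N
      obtain ⟨c, hc⟩ := hpow N
      rw [hc]
      exact Ideal.mem_sup_right
        (Ideal.mul_mem_right _ _ (Ideal.pow_mem_pow (x_mem hm) N))
    rw [Ideal.mem_bot] at hb0
    exact hb (hb0 ▸ good_zero)
  classical
  obtain ⟨φ, hφbad, hφn⟩ := Nat.find_spec hex
  have hmin : ∀ s, s ∉ Ideal.span {x} ⊔ maximalIdeal R ^ (Nat.find hex) → good s := by
    intro s hs
    by_contra hbad
    rcases hn : Nat.find hex with _ | k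
    · rw [hn] at hs; simp at hs
    · rw [hn] at hs
      exact Nat.find_min hex (m := k) (by omega) ⟨s, hbad, hs⟩
  have hφn' : φ ∈ Ideal.span {x} ⊔ maximalIdeal R ^ (Nat.find hex) := by
    by_contra h
    exact hφbad (hmin φ h)
  -- division by `φ`
  have hdiv : ∀ h : R, ∃ q r, h = q * φ + r ∧ good r := by
    intro h
    by_contra hno
    have hpow : ∀ N : ℕ, ∃ q s, h = q * φ + x ^ N * s := by
      intro N
      induction N with
      | zero => exact ⟨0, h, by simp⟩
      | succ N ih =>
        obtain ⟨q, s, hqs⟩ := ih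
        by_cases hs : s ∈ Ideal.span {x} ⊔ maximalIdeal R ^ (Nat.find hex)
        · obtain ⟨q', s', rfl⟩ := div_aux hm _ φ s hφn' hφn hs
          exact ⟨q + x ^ N * q', s', by rw [hqs]; ring⟩
        · exact absurd ⟨q, x ^ N * s, hqs, good_mul _ _ (good_x N) (hmin s hs)⟩ hno
    have hmem : h ∈ Ideal.span {φ} := by
      apply krull_aux
      intro N
      obtain ⟨q, s, hqs⟩ := hpow N
      rw [hqs]
      refine Ideal.add_mem _ (Ideal.mem_sup_left ?_) (Ideal.mem_sup_right ?_)
      · exact Ideal.mul_mem_left _ _ (Ideal.mem_span_singleton_self φ)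
      · exact Ideal.mul_mem_right _ _ (Ideal.pow_mem_pow (x_mem hm) N)
    obtain ⟨q, hq⟩ := Ideal.mem_span_singleton'.1 hmem
    exact hno ⟨q, 0, by rw [hq, add_zero], good_zero⟩
  have hφm : φ ∈ maximalIdeal R := by
    by_contra h
    have hu : IsUnit φ := by
      by_contra h'
      exact h h'
    exact hφbad ⟨by rw [σ.map_unit hu, μ.map_unit hu], by rw [τ.map_unit hu, μ.map_unit hu]⟩
  rcases le_total (σ.v φ) (τ.v φ) with hle | hle
  · left
    have hlt : σ.v φ < μ.v φ := by
      refine lt_of_le_of_ne (hσ φ) fun he => hφbad ⟨he, ?_⟩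
      exact le_antisymm (hτ φ) (he ▸ hle)
    exact le_of_division hσ hlt (one_le hσn hφm) hle hdiv
  · right
    have hlt : τ.v φ < μ.v φ := by
      refine lt_of_le_of_ne (hτ φ) fun he => hφbad ⟨?_, he⟩
      exact le_antisymm (hσ φ) (he ▸ hle)
    refine le_of_division hτ hlt (one_le hτn hφm) hle ?_
    intro h
    obtain ⟨q, r, h1, h2, h3⟩ := hdiv h
    exact ⟨q, r, h1, h3, h2⟩

end CenteredValn

end Valuations

/-- Let `(R, 𝔪)` be a regular local ring of Krull dimension 2.
For any two normalized centered valuations `μ, ν` on `R` there exists a normalized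
centered valuation `ρ` with `ρ ≤ μ`, `ρ ≤ ν`, and such that every normalized
centered valuation `σ` with `σ ≤ μ` and `σ ≤ ν` satisfies `σ ≤ ρ`; i.e. the
infimum of `μ` and `ν` exists in the poset `𝒱`. -/
theorem infimum_exists
    (R : Type*) [CommRing R] [IsDomain R] [IsNoetherianRing R] [IsLocalRing R]
    (hdim : ringKrullDim R = 2)
    (hreg : ∃ x y : R, maximalIdeal R = Ideal.span {x, y})
    (μ ν : CenteredValn R) (hμ : μ.Normalized) (hν : ν.Normalized) :
    ∃ ρ : CenteredValn R, ρ.Normalized ∧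
      (∀ f : R, ρ.v f ≤ μ.v f) ∧ (∀ f : R, ρ.v f ≤ ν.v f) ∧
      ∀ σ : CenteredValn R, σ.Normalized →
        (∀ f : R, σ.v f ≤ μ.v f) → (∀ f : R, σ.v f ≤ ν.v f) →
        ∀ f : R, σ.v f ≤ ρ.v f := by
  classical
  let S : Set (CenteredValn R) := {σ | σ.Normalized ∧ (∀ f, σ.v f ≤ μ.v f) ∧
    (∀ f, σ.v f ≤ ν.v f)}
  let V : R → EReal := fun f => ⨆ σ : S, σ.1.v f
  let o : CenteredValn R := CenteredValn.ordVal hdim hreg hμ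
  have hoμ : ∀ f, o.v f ≤ μ.v f := CenteredValn.multVal_le hμ
  have hoν : ∀ f, o.v f ≤ ν.v f := CenteredValn.multVal_le hν
  have ho1 : ∀ f ∈ maximalIdeal R, 1 ≤ o.v f := by
    intro f hf
    have := le_multVal (n := 1) (f := f) (by simpa using hf)
    rw [Nat.cast_one] at this
    exact this
  have hoS : o ∈ S := ⟨CenteredValn.normalized_of hμ hoμ ho1, hoμ, hoν⟩
  have hle : ∀ σ ∈ S, ∀ f, σ.v f ≤ V f := fun σ hσ f =>
    le_iSup (fun σ : S => σ.1.v f) ⟨σ, hσ⟩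
  have hVμ : ∀ f, V f ≤ μ.v f := fun f => iSup_le fun σ => σ.2.2.1 f
  have hVν : ∀ f, V f ≤ ν.v f := fun f => iSup_le fun σ => σ.2.2.2 f
  have hdir : ∀ σ ∈ S, ∀ τ ∈ S, ∃ κ ∈ S, (∀ f, σ.v f ≤ κ.v f) ∧ (∀ f, τ.v f ≤ κ.v f) := by
    intro σ hσ τ hτ
    rcases CenteredValn.total_below hreg hσ.1 hτ.1 hμ hσ.2.1 hτ.2.1 with h | h
    · exact ⟨τ, hτ, h, fun f => le_rfl⟩
    · exact ⟨σ, hσ, fun f => le_rfl, h⟩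
  have hV1 : ∀ f ∈ maximalIdeal R, 1 ≤ V f := fun f hf => (ho1 f hf).trans (hle o hoS f)
  let ρ : CenteredValn R :=
    { v := V
      map_mul := by
        intro f g
        apply le_antisymm
        · refine iSup_le fun σ => ?_
          rw [σ.1.map_mul]
          exact add_le_add (hle _ σ.2 f) (hle _ σ.2 g)
        · apply EReal.add_le_of_forall_lt
          intro a ha b hb
          obtain ⟨σ, hσ⟩ := lt_iSup_iff.1 ha
          obtain ⟨τ, hτ⟩ := lt_iSup_iff.1 hb
          obtain ⟨κ, hκ, h1, h2⟩ := hdir _ σ.2 _ τ.2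
          refine le_trans ?_ (hle κ hκ (f * g))
          rw [κ.map_mul]
          exact add_le_add (hσ.le.trans (h1 f)) (hτ.le.trans (h2 g))
      add_ge := by
        intro f g
        by_contra hc
        push Not at hc
        rw [lt_min_iff] at hc
        obtain ⟨σ, hσ⟩ := lt_iSup_iff.1 hc.1
        obtain ⟨τ, hτ⟩ := lt_iSup_iff.1 hc.2
        obtain ⟨κ, hκ, h1, h2⟩ := hdir _ σ.2 _ τ.2
        have h3 := (κ.add_ge f g).trans (hle κ hκ (f + g))
        exact absurd h3 (not_le.2 (lt_min (hσ.trans_le (h1 f)) (hτ.trans_le (h2 g))))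
      map_one := le_antisymm ((hVμ 1).trans_eq μ.map_one) ((o.nonneg 1).trans (hle o hoS 1))
      nonneg := fun f => (o.nonneg f).trans (hle o hoS f)
      pos := fun f hf => lt_of_lt_of_le (o.pos f hf) (hle o hoS f)
      proper := by
        obtain ⟨f, hf, h⟩ := μ.proper
        exact ⟨f, hf, ne_top_of_le_ne_top h (hVμ f)⟩ }
  exact ⟨ρ, CenteredValn.normalized_of (σ := ρ) hμ hVμ hV1, hVμ, hVν,
    fun σ h1 h2 h3 f => hle σ ⟨h1, h2, h3⟩ f⟩
end

section
/- Let (R, 𝔪) be a regular local ring of Krull dimension 2. The poset 𝒱 of normalized centered valuations on R is a complete nonmetric tree rooted at the multiplicity valuation ν_𝔪; explicitly: (i) ν_𝔪, defined by ν_𝔪(f) := sup{i ∈ ℕ : f ∈ 𝔪^i}, is the unique smallest element of 𝒱; (ii) for every ν ∈ 𝒱, the set {μ ∈ 𝒱 : μ ≤ ν} with the induced order is order-isomorphic to an interval of ℝ ∪ {∞}; (iii) every nonempty totally ordered convex subset of 𝒱 is order-isomorphic to an interval of ℝ ∪ {∞}; (iv) every nonempty subset of 𝒱 has an infimum in 𝒱;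 (v) every increasing sequence (ν_n)_{n∈ℕ} in 𝒱 has an upper bound in 𝒱. -/
open IsLocalRing

/-- The poset `𝒱` of normalized centered valuations on `R`, ordered pointwise. -/
def ValSpace (R : Type*) [CommRing R] [IsLocalRing R] :=
  {ν : CenteredValn R // ν.Normalized}

noncomputable instance (R : Type*) [CommRing R] [IsLocalRing R] :
    PartialOrder (ValSpace R) where
  le μ ν := ∀ f : R, μ.1.v f ≤ ν.1.v f
  le_refl μ f := le_refl _
  le_trans a b c hab hbc f := le_trans (hab f) (hbc f)
  le_antisymm a b hab hba := by
    rcases a with ⟨⟨av, _, _, _, _, _, _⟩, _⟩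
    rcases b with ⟨⟨bv, _, _, _, _, _, _⟩, _⟩
    have h : av = bv := funext fun f => le_antisymm (hab f) (hba f)
    subst h
    rfl

namespace VTree

set_option linter.unusedSectionVars false

open Ideal

variable {R : Type*} [CommRing R] [IsDomain R] [IsNoetherianRing R] [IsLocalRing R] {x y : R}

/-- `x, y` are regular parameters. -/
structure Par (x y : R) : Prop where
  hm : maximalIdeal R = Ideal.span {x, y}
  hy : ∀ k, ¬ x ∣ y ^ k
  hx0 : x ≠ 0

omit [IsDomain R] in
theorem mkPar_aux (hdim : ringKrullDim R = 2) (hm : maximalIdeal R = Ideal.span {x, y})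
    (k : ℕ) : ¬ x ∣ y ^ k := by
  intro hk
  have hmin : maximalIdeal R ∈ (Ideal.span {x}).minimalPrimes := by
    refine ⟨⟨inferInstance, ?_⟩, ?_⟩
    · rw [hm]; exact Ideal.span_mono (by simp)
    · rintro q ⟨hq, hxq⟩ -
      rw [hm, Ideal.span_le]
      have hx : x ∈ q := hxq (Ideal.mem_span_singleton_self x)
      have hy : y ∈ q := hq.mem_of_pow_mem k (q.mem_of_dvd hk hx)
      rintro z (rfl | rfl)
      · exact hx
      · exact hy
  have h1 := Ideal.height_le_one_of_isPrincipal_of_mem_minimalPrimes _ _ hmin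
  have h2 := IsLocalRing.maximalIdeal_height_eq_ringKrullDim (R := R)
  rw [hdim] at h2
  have h3 : (maximalIdeal R).height = 2 := WithBot.coe_injective h2
  rw [h3] at h1
  exact absurd h1 (by decide)

omit [IsDomain R] in
theorem mkPar (hdim : ringKrullDim R = 2) (hm : maximalIdeal R = Ideal.span {x, y}) :
    Par x y := by
  refine ⟨hm, mkPar_aux hdim hm, ?_⟩
  rintro rfl
  rw [Set.pair_comm] at hm
  exact mkPar_aux hdim hm 1 (by simp)

omit [IsDomain R] in
theorem krull (a : R) (ha : a ∈ maximalIdeal R) (g h : R)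
    (H : ∀ j : ℕ, ∃ c d, h = c * a ^ j + d * g) : g ∣ h := by
  have hne : Ideal.span {a} ≠ ⊤ := by
    intro h
    rw [Ideal.span_singleton_eq_top] at h
    exact (mem_maximalIdeal a).1 ha h
  have := Ideal.iInf_pow_smul_eq_bot_of_isLocalRing (M := R ⧸ Ideal.span {g})
    (Ideal.span {a}) hne
  have hmem : (Ideal.Quotient.mk (Ideal.span {g}) h) ∈
      (⨅ i : ℕ, (Ideal.span {a}) ^ i • (⊤ : Submodule R (R ⧸ Ideal.span {g}))) := by
    rw [Submodule.mem_iInf]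
    intro j
    obtain ⟨c, d, hcd⟩ := H j
    have h0 : (Ideal.Quotient.mk (Ideal.span {g}) h) =
        a ^ j • (Ideal.Quotient.mk (Ideal.span {g}) c) := by
      rw [Algebra.smul_def, Ideal.Quotient.algebraMap_eq, ← map_mul, Ideal.Quotient.eq,
        Ideal.mem_span_singleton]
      exact ⟨d, by rw [hcd]; ring⟩
    rw [h0]
    exact Submodule.smul_mem_smul (Ideal.pow_mem_pow (Ideal.mem_span_singleton_self a) j) trivial
  rw [this, Submodule.mem_bot, Ideal.Quotient.eq_zero_iff_mem, Ideal.mem_span_singleton] at hmem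
  exact hmem

/-- maximal exponent form of `krull` -/
theorem krull' (a : R) (ha : a ∈ maximalIdeal R) (g h : R) (hgh : ¬ g ∣ h) :
    ∃ (j : ℕ) (c d : R), h = c * a ^ j + d * g ∧ ¬ ∃ e e', c = e * a + e' * g := by
  classical
  by_contra hcon
  push Not at hcon
  apply hgh
  apply krull a ha g h
  intro j
  induction j with
  | zero => exact ⟨h, 0, by simp⟩
  | succ j ih =>
    obtain ⟨c, d, hcd⟩ := ih
    obtain ⟨e, e', he⟩ := hcon j c d hcd
    exact ⟨e, d + e' * a ^ j, by rw [hcd, he]; ring⟩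

/-- `D x y k f`: the order of `f` in `R/x` is `k`. -/
def D (x y : R) (k : ℕ) (f : R) : Prop := ∃ u a, IsUnit u ∧ f = u * y ^ k + a * x

namespace Par

variable (P : Par x y)
include P

theorem xm : x ∈ maximalIdeal R := by rw [P.hm]; exact Ideal.subset_span (by simp)
theorem ym : y ∈ maximalIdeal R := by rw [P.hm]; exact Ideal.subset_span (by simp)

theorem D_exists {f : R} (hf : ¬ x ∣ f) : ∃ k, D x y k f := by
  obtain ⟨j, c, d, h, hc⟩ := krull' y P.ym x f hf
  refine ⟨j, c, d, ?_, h⟩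
  by_contra hu
  have : c ∈ maximalIdeal R := (mem_maximalIdeal c).2 hu
  rw [P.hm, Ideal.mem_span_pair] at this
  obtain ⟨a, b, hab⟩ := this
  exact hc ⟨b, a, by rw [← hab]; ring⟩

theorem D_le {f : R} {k l : ℕ} (h : D x y k f) {c a : R} (hf : f = c * y ^ l + a * x) :
    l ≤ k := by
  by_contra hlt
  push Not at hlt
  obtain ⟨u, b, hu, h⟩ := h
  obtain ⟨m, rfl⟩ := Nat.exists_eq_add_of_lt hlt
  have hv : IsUnit (u - c * y ^ (m + 1)) := by
    by_contra hn
    have h1 : u - c * y ^ (m + 1) ∈ maximalIdeal R := (mem_maximalIdeal _).2 hn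
    have h2 : c * y ^ (m + 1) ∈ maximalIdeal R :=
      Ideal.mul_mem_left _ _ (Ideal.pow_mem_of_mem _ P.ym _ (Nat.succ_pos m))
    have h3 := Ideal.add_mem _ h1 h2
    rw [sub_add_cancel] at h3
    exact (mem_maximalIdeal _).1 h3 hu
  apply P.hy k
  have : x ∣ (u - c * y ^ (m + 1)) * y ^ k := ⟨a - b, by
    have := h.symm.trans hf
    rw [add_assoc, pow_add] at this
    linear_combination this⟩
  exact (hv.dvd_mul_left).1 this

theorem D_unique {f : R} {k l : ℕ} (h : D x y k f) (h' : D x y l f) : k = l := by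
  obtain ⟨u, b, hu, h1⟩ := h
  obtain ⟨u', b', hu', h1'⟩ := h'
  exact le_antisymm (P.D_le ⟨u', b', hu', h1'⟩ h1) (P.D_le ⟨u, b, hu, h1⟩ h1')

omit [IsDomain R] [IsNoetherianRing R] [IsLocalRing R] P in
theorem _root_.VTree.D_mul {f g : R} {k l : ℕ} (h : D x y k f) (h' : D x y l g) :
    D x y (k + l) (f * g) := by
  obtain ⟨u, b, hu, rfl⟩ := h
  obtain ⟨u', b', hu', rfl⟩ := h'
  exact ⟨u * u', u * y ^ k * b' + b * (u' * y ^ l + b' * x), hu.mul hu', by ring⟩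

theorem D_not_dvd {f : R} {k : ℕ} (h : D x y k f) : ¬ x ∣ f := by
  rintro ⟨c, hc⟩
  have := P.D_le h (c := 0) (l := k + 1) (a := c) (by rw [hc]; ring)
  omega

theorem xprime : Prime x := by
  refine ⟨P.hx0, (mem_maximalIdeal x).1 P.xm, fun a b hab => ?_⟩
  by_contra hcon
  push Not at hcon
  obtain ⟨k, hk⟩ := P.D_exists hcon.1
  obtain ⟨l, hl⟩ := P.D_exists hcon.2
  exact P.D_not_dvd (D_mul hk hl) hab

theorem D_zero_unit {f : R} (h : D x y 0 f) : IsUnit f := by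
  obtain ⟨u, a, hu, rfl⟩ := h
  by_contra hn
  have h1 : u * y ^ 0 + a * x ∈ maximalIdeal R := (mem_maximalIdeal _).2 hn
  have h2 : a * x ∈ maximalIdeal R := Ideal.mul_mem_left _ _ P.xm
  have h3 := Ideal.sub_mem _ h1 h2
  simp at h3
  exact h3 hu

theorem D_mem {f : R} {n : ℕ} (hn : 0 < n) (h : D x y n f) : f ∈ maximalIdeal R := by
  obtain ⟨u, a, hu, rfl⟩ := h
  exact Ideal.add_mem _ (Ideal.mul_mem_left _ _ (Ideal.pow_mem_of_mem _ P.ym _ hn))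
    (Ideal.mul_mem_left _ _ P.xm)

/-- Elements small with respect to degree `n`. -/
def _root_.VTree.Small (x y : R) (n : ℕ) (r : R) : Prop :=
  r = 0 ∨ ∃ (j l : ℕ) (r' : R), r = x ^ j * r' ∧ l < n ∧ D x y l r'

/-- Weierstrass type division. -/
theorem division {f : R} {n : ℕ} (hf : D x y n f) (h : R) :
    ∃ q r, h = q * f + r ∧ Small x y n r := by
  by_cases hd : f ∣ h
  · obtain ⟨c, rfl⟩ := hd
    exact ⟨c, 0, by ring, Or.inl rfl⟩
  · obtain ⟨j, c, d, h1, hc⟩ := krull' x P.xm f h hd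
    have hxc : ¬ x ∣ c := by
      rintro ⟨e, rfl⟩
      exact hc ⟨e, 0, by ring⟩
    obtain ⟨l, hl⟩ := P.D_exists hxc
    refine ⟨d, x ^ j * c, by rw [h1]; ring, Or.inr ⟨j, l, c, rfl, ?_, hl⟩⟩
    by_contra hnl
    push Not at hnl
    obtain ⟨m, rfl⟩ := Nat.exists_eq_add_of_le hnl
    obtain ⟨u, a, hu, hfu⟩ := hf
    obtain ⟨u', a', hu', hcu⟩ := hl
    obtain ⟨ui, rfl⟩ := hu
    apply hc
    refine ⟨a' - u' * y ^ m * ↑ui⁻¹ * a, u' * y ^ m * ↑ui⁻¹, ?_⟩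
    rw [hcu, hfu]
    have := ui.inv_mul
    rw [pow_add]
    linear_combination (-u' * y ^ m * y ^ n) * this

theorem strip {h : R} (hh : h ≠ 0) : ∃ (j l : ℕ) (f : R), h = x ^ j * f ∧ D x y l f := by
  obtain ⟨c, h1, h2⟩ := (FiniteMultiplicity.of_not_isUnit ((mem_maximalIdeal x).1 P.xm) hh
    ).exists_eq_pow_mul_and_not_dvd
  obtain ⟨l, hl⟩ := P.D_exists h2
  exact ⟨_, l, c, h1, hl⟩

theorem pow_succ_mem {N : ℕ} {h : R} (hh : h ∈ maximalIdeal R ^ (N + 1)) :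
    ∃ h' ∈ maximalIdeal R ^ N, ∃ c, h = x * h' + c * y ^ (N + 1) := by
  induction N generalizing h with
  | zero =>
    rw [zero_add, pow_one, P.hm, Ideal.mem_span_pair] at hh
    obtain ⟨a, b, hab⟩ := hh
    exact ⟨a, by simp, b, by rw [← hab]; ring⟩
  | succ N ih =>
    rw [_root_.pow_succ] at hh
    refine Submodule.mul_induction_on hh ?_ ?_
    · intro p hp q hq
      obtain ⟨p', hp', c, hc⟩ := ih hp
      rw [P.hm, Ideal.mem_span_pair] at hq
      obtain ⟨a, b, hab⟩ := hq
      refine ⟨p * a + p' * b * y, ?_, c * b, ?_⟩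
      · refine Ideal.add_mem _ (Ideal.mul_mem_right _ _ hp) ?_
        rw [mul_right_comm]
        refine Ideal.mul_mem_right _ _ ?_
        rw [_root_.pow_succ]
        exact Ideal.mul_mem_mul hp' P.ym
      · rw [← hab]
        linear_combination (b * y) * hc
    · rintro p q ⟨p', hp', c, hc⟩ ⟨q', hq', d, hd⟩
      exact ⟨p' + q', Ideal.add_mem _ hp' hq', c + d, by rw [hc, hd]; ring⟩

theorem cancel_x {N : ℕ} {h : R} (hh : x * h ∈ maximalIdeal R ^ (N + 1)) :
    h ∈ maximalIdeal R ^ N := by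
  obtain ⟨h', hh', c, hc⟩ := P.pow_succ_mem hh
  have hp := P.xprime
  have : x ∣ c * y ^ (N + 1) := ⟨h - h', by linear_combination -hc⟩
  obtain ⟨e, rfl⟩ := (hp.dvd_or_dvd this).resolve_right (P.hy _)
  have : h = h' + e * y ^ (N + 1) := mul_left_cancel₀ P.hx0 (by rw [hc]; ring)
  rw [this]
  refine Ideal.add_mem _ hh' (Ideal.mul_mem_left _ _ ?_)
  exact Ideal.pow_le_pow_right (Nat.le_succ N) (Ideal.pow_mem_pow P.ym _)

theorem gr_domain_aux {i : ℕ} {f : R}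
    (hf : f ∈ maximalIdeal R ^ i) (hf' : f ∉ maximalIdeal R ^ (i + 1)) (hD : ¬ D x y i f) :
    ∃ i', i = i' + 1 ∧ ∃ f', f' ∈ maximalIdeal R ^ i' ∧ f' ∉ maximalIdeal R ^ (i' + 1) ∧
      ∃ c, f = x * f' + c * y ^ (i + 1) := by
  cases i with
  | zero =>
    exfalso; apply hD
    rw [zero_add, pow_one] at hf'
    refine ⟨f, 0, ?_, by ring⟩
    by_contra hn
    exact hf' ((mem_maximalIdeal _).2 hn)
  | succ i =>
    refine ⟨i, rfl, ?_⟩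
    obtain ⟨f', h1, c, h2⟩ := P.pow_succ_mem hf
    have hc : ¬ IsUnit c := fun hu => hD ⟨c, f', hu, by rw [h2]; ring⟩
    have hc' : c ∈ maximalIdeal R := (mem_maximalIdeal _).2 hc
    rw [P.hm, Ideal.mem_span_pair] at hc'
    obtain ⟨a, b, rfl⟩ := hc'
    have hyy : y ^ (i + 1) ∈ maximalIdeal R ^ (i + 1) := Ideal.pow_mem_pow P.ym _
    have heq : f = x * (f' + a * y ^ (i + 1)) + b * y ^ (i + 1 + 1) := by rw [h2]; ring
    refine ⟨f' + a * y ^ (i + 1), ?_, ?_, b, heq⟩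
    · exact Ideal.add_mem _ h1 (Ideal.mul_mem_left _ _
        (Ideal.pow_le_pow_right (Nat.le_succ i) hyy))
    · intro hmem
      apply hf'
      rw [heq]
      refine Ideal.add_mem _ ?_ (Ideal.mul_mem_left _ _ (Ideal.pow_mem_pow P.ym _))
      rw [_root_.pow_succ, mul_comm x]
      exact Ideal.mul_mem_mul hmem P.xm

theorem gr_domain (s : ℕ) : ∀ (i j : ℕ) (f g : R), i + j = s →
    f ∈ maximalIdeal R ^ i → f ∉ maximalIdeal R ^ (i + 1) →
    g ∈ maximalIdeal R ^ j → g ∉ maximalIdeal R ^ (j + 1) →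
    f * g ∉ maximalIdeal R ^ (s + 1) := by
  induction s with
  | zero =>
    intro i j f g hij hf hf' hg hg'
    obtain ⟨rfl, rfl⟩ : i = 0 ∧ j = 0 := by omega
    rw [zero_add, pow_one, mem_maximalIdeal, mem_nonunits_iff, not_not] at *
    exact hf'.mul hg'
  | succ s ih =>
    have key : ∀ (i j : ℕ) (f g : R), i + j = s + 1 →
      f ∈ maximalIdeal R ^ i → f ∉ maximalIdeal R ^ (i + 1) →
      g ∈ maximalIdeal R ^ j → g ∉ maximalIdeal R ^ (j + 1) → ¬ D x y i f →
      f * g ∉ maximalIdeal R ^ (s + 1 + 1) := by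
      intro i j f g hij hf hf' hg hg' hD hmem
      obtain ⟨i', rfl, f', h1, h2, c, h3⟩ := P.gr_domain_aux hf hf' hD
      apply ih i' j f' g (by omega) h1 h2 hg hg'
      apply P.cancel_x
      have : x * (f' * g) = f * g - c * (y ^ (i' + 1 + 1) * g) := by rw [h3]; ring
      rw [this]
      refine Ideal.sub_mem _ hmem (Ideal.mul_mem_left _ _ ?_)
      have : s + 1 + 1 = (i' + 1 + 1) + j := by omega
      rw [this, pow_add]
      exact Ideal.mul_mem_mul (Ideal.pow_mem_pow P.ym _) hg
    intro i j f g hij hf hf' hg hg'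
    by_cases hD : D x y i f
    · by_cases hD' : D x y j g
      · intro hmem
        have := D_mul hD hD'
        obtain ⟨h', _, c, hc⟩ := P.pow_succ_mem hmem
        have := P.D_le this (c := c) (a := h') (l := s + 1 + 1) (by rw [hc]; ring)
        omega
      · rw [mul_comm]
        exact key j i g f (by omega) hg hg' hf hf' hD'
    · exact key i j f g hij hf hf' hg hg' hD

end Par

end VTree

namespace VTree

open scoped ENNReal
open Polynomial (X C coeff eval)

variable {R : Type*} [CommRing R]

/-- Basic valuation axioms with values in `[0,∞]`. -/
structure PV (w : R → ℝ≥0∞) : Prop where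
  map_mul : ∀ f g, w (f * g) = w f + w g
  add_ge : ∀ f g, min (w f) (w g) ≤ w (f + g)
  map_one : w 1 = 0
  map_zero : w 0 = ⊤

namespace PV

variable {w : R → ℝ≥0∞} (hw : PV w)
include hw

theorem map_unit {u : R} (hu : IsUnit u) : w u = 0 := by
  obtain ⟨v, hv⟩ := hu.exists_right_inv
  have := hw.map_mul u v
  rw [hv, hw.map_one] at this
  exact (add_eq_zero.1 this.symm).1

theorem map_neg (a : R) : w (-a) = w a := by
  rw [neg_eq_neg_one_mul, hw.map_mul, hw.map_unit (isUnit_one.neg), zero_add]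

theorem sub_ge (a b : R) : min (w a) (w b) ≤ w (a - b) := by
  rw [sub_eq_add_neg, ← hw.map_neg b]; exact hw.add_ge _ _

theorem add_eq {a b : R} (h : w a < w b) : w (a + b) = w a := by
  apply le_antisymm
  · by_contra hc
    push Not at hc
    have := hw.sub_ge (a + b) b
    rw [add_sub_cancel_right] at this
    exact absurd this (not_le.2 (lt_min hc h))
  · exact le_trans (le_min le_rfl h.le) (hw.add_ge a b)

theorem map_pow (a : R) (k : ℕ) : w (a ^ k) = k * w a := by
  induction k with
  | zero => simp [hw.map_one]
  | succ k ih => rw [pow_succ, hw.map_mul, ih]; push_cast; ring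

theorem sum_lt {ι : Type*} (s : Finset ι) (F : ι → R) {c : ℝ≥0∞} (hc : c ≠ ⊤)
    (h : ∀ i ∈ s, c < w (F i)) : c < w (∑ i ∈ s, F i) := by
  classical
  induction s using Finset.induction_on with
  | empty => simp [hw.map_zero, lt_top_iff_ne_top, hc]
  | insert a s ha ih =>
    rw [Finset.sum_insert ha]
    exact lt_of_lt_of_le (lt_min (h a (by simp))
      (ih fun i hi => h i (by simp [hi]))) (hw.add_ge _ _)

theorem sum_le {ι : Type*} (s : Finset ι) (F : ι → R) {c : ℝ≥0∞}
    (h : ∀ i ∈ s, c ≤ w (F i)) : c ≤ w (∑ i ∈ s, F i) := by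
  classical
  induction s using Finset.induction_on with
  | empty => simp [hw.map_zero]
  | insert a s ha ih =>
    rw [Finset.sum_insert ha]
    exact le_trans (le_min (h a (by simp))
      (ih fun i hi => h i (by simp [hi]))) (hw.add_ge _ _)

end PV

/-- `f` is a key element for the pair `μ ≤ ν`, with small set `S`. -/
structure Key (μ ν : R → ℝ≥0∞) (S : Set R) (f : R) : Prop where
  hμ : PV μ
  hν : PV ν
  le : ∀ h, μ h ≤ ν h
  lt : μ f < ν f
  pos : 0 < μ f
  eqS : ∀ r ∈ S, μ r = ν r
  div : ∀ h, ∃ q r, h = q * f + r ∧ r ∈ S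

namespace Key

variable {μ ν : R → ℝ≥0∞} {S : Set R} {f : R} (K : Key μ ν S f)
include K

theorem ne_top : μ f ≠ ⊤ := K.lt.ne_top

theorem le_r (q : R) {r : R} (hr : r ∈ S) : μ (q * f + r) ≤ μ r := by
  by_contra hc
  push Not at hc
  have h1 : μ (q * f) = μ r := by
    have := K.hμ.add_eq (a := -r) (b := q * f + r) (by rwa [K.hμ.map_neg])
    rw [K.hμ.map_neg] at this
    rw [← this]; congr 1; ring
  have h2 : ν (q * f) = μ r := by
    have := K.hν.add_eq (a := -r) (b := q * f + r)
      (by rw [K.hν.map_neg, ← K.eqS r hr]; exact lt_of_lt_of_le hc (K.le _))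
    rw [K.hν.map_neg, ← K.eqS r hr] at this
    rw [← this]; congr 1; ring
  rw [K.hμ.map_mul] at h1
  rw [K.hν.map_mul] at h2
  have hq : μ q ≠ ⊤ := by
    intro h
    rw [h, top_add] at h1
    rw [← h1] at hc
    exact absurd hc (by simp)
  have := ENNReal.add_lt_add_of_le_of_lt hq (K.le q) K.lt
  rw [h1, h2] at this
  exact lt_irrefl _ this

theorem le_q (q : R) {r : R} (hr : r ∈ S) : μ (q * f + r) ≤ μ q + μ f := by
  rw [← K.hμ.map_mul]
  have := K.hμ.sub_ge (q * f + r) r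
  rw [add_sub_cancel_right, min_eq_left (K.le_r q hr)] at this
  exact this

/-- Comparison lemma. -/
theorem compare {μ' : R → ℝ≥0∞} (h' : PV μ') (hS : ∀ r ∈ S, μ r ≤ μ' r) (hf : μ f ≤ μ' f)
    (h : R) : μ h ≤ μ' h := by
  have key : ∀ (k : ℕ) (h : R), min (μ h) (k * μ f) ≤ μ' h := by
    intro k
    induction k with
    | zero => intro h; simp
    | succ k ih =>
      intro h
      obtain ⟨q, r, rfl, hr⟩ := K.div h
      refine le_trans (le_min ?_ ?_) (h'.add_ge _ _)
      · rw [h'.map_mul]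
        refine le_trans ?_ (add_le_add (ih q) hf)
        rw [min_add]
        refine min_le_min (K.le_q q hr) ?_
        push_cast
        rw [add_mul, one_mul]
      · exact (min_le_left _ _).trans ((K.le_r q hr).trans (hS r hr))
  by_contra hc
  push Not at hc
  have hk : ∀ k : ℕ, k * μ f ≤ μ' h := by
    intro k
    have := key k h
    rcases min_le_iff.1 this with h1 | h1
    · exact absurd h1 (not_le.2 hc)
    · exact h1
  obtain ⟨n, hn⟩ := ENNReal.exists_nat_mul_gt K.pos.ne' hc.ne_top
  exact absurd (hk n) (not_le.2 hn)

end Key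

/-- Optimal representations. -/
structure Opt (μ ν : R → ℝ≥0∞) (t : ℝ≥0∞) (U : Polynomial R) (v : ℝ≥0∞) (i0 : ℕ) : Prop where
  fin : v ≠ ⊤
  le : ∀ i : ℕ, v ≤ μ (U.coeff i) + i * t
  eq : ν (U.coeff i0) + i0 * t = v
  lt : ∀ i : ℕ, i < i0 → v < ν (U.coeff i) + i * t

/-- The augmented valuation. -/
noncomputable def aug (μ : R → ℝ≥0∞) (f : R) (t : ℝ≥0∞) (h : R) : ℝ≥0∞ :=
  ⨆ (U : Polynomial R) (_ : U.eval f = h), ⨅ i : ℕ, (μ (U.coeff i) + i * t)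

section aug

variable {μ ν : R → ℝ≥0∞} {S : Set R} {f : R} (K : Key μ ν S f) {t : ℝ≥0∞}
  (ht : μ f < t) (ht' : t ≤ ν f) (htop : t ≠ ⊤)

include K

theorem Key.aug_ge (h : R) : μ h ≤ aug μ f t h := by
  refine le_iSup₂_of_le (C h) (by simp) (le_iInf fun i => ?_)
  cases i with
  | zero => simp
  | succ i => simp [Polynomial.coeff_C, K.hμ.map_zero]

include ht' in
theorem Key.aug_le (h : R) : aug μ f t h ≤ ν h := by
  refine iSup₂_le fun U hU => ?_
  rw [← hU, Polynomial.eval_eq_sum_range]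
  refine K.hν.sum_le _ _ fun i _ => (iInf_le _ i).trans ?_
  rw [K.hν.map_mul, K.hν.map_pow]
  gcongr
  exact K.le _

theorem Key.aug_add (a b : R) : min (aug μ f t a) (aug μ f t b) ≤ aug μ f t (a + b) := by
  refine le_of_forall_lt fun c hc => ?_
  obtain ⟨h1, h2⟩ := lt_min_iff.1 hc
  simp only [aug, lt_iSup_iff] at h1 h2
  obtain ⟨U, hU, h1⟩ := h1
  obtain ⟨V, hV, h2⟩ := h2
  refine lt_of_lt_of_le (lt_min h1 h2) ?_
  refine le_iSup₂_of_le (U + V) (by simp [hU, hV]) (le_iInf fun i => ?_)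
  rw [Polynomial.coeff_add]
  refine le_trans ?_ (add_le_add (K.hμ.add_ge _ _) le_rfl)
  rw [min_add]
  exact min_le_min (iInf_le _ i) (iInf_le _ i)

include ht htop in
theorem Key.opt_unique [IsDomain R] {U : Polynomial R} {v : ℝ≥0∞} {i0 : ℕ}
    (hU : Opt μ ν t U v i0) : aug μ f t (U.eval f) = v := by
  apply le_antisymm
  · refine iSup₂_le fun T hT => ?_
    by_contra hc
    push Not at hc
    have hT' : ∀ i : ℕ, v < μ (T.coeff i) + i * t := fun i => lt_of_lt_of_le hc (iInf_le _ i)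
    have hroot : (U - T).IsRoot f := by simp [hT]
    obtain ⟨Q, hQ⟩ := Polynomial.dvd_iff_isRoot.2 hroot
    have hz : ∀ i : ℕ, v ≤ μ ((U - T).coeff i) + i * t := by
      intro i
      rw [Polynomial.coeff_sub]
      refine le_trans ?_ (add_le_add (K.hμ.sub_ge _ _) le_rfl)
      rw [min_add]
      exact le_min (hU.le i) (hT' i).le
    have c0 : (U - T).coeff 0 = - (f * Q.coeff 0) := by
      rw [hQ, Polynomial.mul_coeff_zero]; simp
    have cs : ∀ i, (U - T).coeff (i + 1) = Q.coeff i - f * Q.coeff (i + 1) := by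
      intro i; rw [hQ, Polynomial.coeff_X_sub_C_mul]
    have step : ∀ i : ℕ, v ≤ μ (f * Q.coeff i) + i * t → v < μ (Q.coeff i) + (i + 1 : ℕ) * t := by
      intro i hi
      rw [K.hμ.map_mul] at hi
      by_cases hq : μ (Q.coeff i) = ⊤
      · rw [hq, top_add]; exact lt_top_iff_ne_top.2 hU.fin
      · refine lt_of_le_of_lt hi ?_
        have : (i : ℝ≥0∞) * t ≠ ⊤ := ENNReal.mul_ne_top (by simp) htop
        calc μ f + μ (Q.coeff i) + i * t = μ f + (μ (Q.coeff i) + i * t) := by ring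
          _ < t + (μ (Q.coeff i) + i * t) :=
            ENNReal.add_lt_add_right (by simp [hq, this]) ht
          _ = _ := by push_cast; ring
    have hq : ∀ i : ℕ, v ≤ μ (f * Q.coeff i) + i * t := by
      intro i
      induction i with
      | zero =>
        have := hz 0
        rwa [c0, K.hμ.map_neg] at this
      | succ i ih =>
        have h1 : f * Q.coeff (i + 1) = Q.coeff i - (U - T).coeff (i + 1) := by rw [cs]; ring
        rw [h1]
        refine le_trans ?_ (add_le_add (K.hμ.sub_ge _ _) le_rfl)
        rw [min_add]
        exact le_min (step i ih).le (hz (i + 1))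
    have hνq : ∀ i : ℕ, v < ν (f * Q.coeff i) + i * t := by
      intro i
      by_cases h : μ (Q.coeff i) = ⊤
      · have := K.le (Q.coeff i)
        rw [h, top_le_iff] at this
        rw [K.hν.map_mul, this]
        simp [lt_top_iff_ne_top, hU.fin]
      · refine lt_of_le_of_lt (hq i) ?_
        rw [K.hμ.map_mul, K.hν.map_mul]
        have h2 : (i : ℝ≥0∞) * t ≠ ⊤ := ENNReal.mul_ne_top (by simp) htop
        exact ENNReal.add_lt_add_right h2 (ENNReal.add_lt_add_of_lt_of_le h K.lt (K.le _))
    have hνz : ∀ i : ℕ, v < ν ((U - T).coeff i) + i * t := by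
      intro i
      cases i with
      | zero => rw [c0, K.hν.map_neg]; exact hνq 0
      | succ i =>
        rw [cs]
        refine lt_of_lt_of_le ?_ (add_le_add (K.hν.sub_ge _ _) le_rfl)
        rw [min_add]
        refine lt_min ((step i (hq i)).trans_le (by gcongr; exact K.le _)) (hνq (i + 1))
    have hlast : v < ν (U.coeff i0) + i0 * t := by
      have : U.coeff i0 = (U - T).coeff i0 + T.coeff i0 := by simp
      rw [this]
      refine lt_of_lt_of_le ?_ (add_le_add (K.hν.add_ge _ _) le_rfl)
      rw [min_add]
      exact lt_min (hνz i0) ((hT' i0).trans_le (by gcongr; exact K.le _))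
    rw [hU.eq] at hlast
    exact lt_irrefl _ hlast
  · exact le_iSup₂_of_le U rfl (le_iInf hU.le)

omit K in
theorem Opt.mul (hν : PV ν) (hμ : PV μ) (hle : ∀ h, μ h ≤ ν h) (htop : t ≠ ⊤)
    {U V : Polynomial R} {v v' : ℝ≥0∞} {i j : ℕ}
    (hU : Opt μ ν t U v i) (hV : Opt μ ν t V v' j) : Opt μ ν t (U * V) (v + v') (i + j) := by
  classical
  have hUn : ∀ i : ℕ, v ≤ ν (U.coeff i) + i * t := fun i =>
    (hU.le i).trans (by gcongr; exact hle _)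
  have hVn : ∀ i : ℕ, v' ≤ ν (V.coeff i) + i * t := fun i =>
    (hV.le i).trans (by gcongr; exact hle _)
  have aux : ∀ (w : R → ℝ≥0∞) (hw : PV w) (a b : ℕ), w (U.coeff a * V.coeff b) + (a + b : ℕ) * t
      = (w (U.coeff a) + a * t) + (w (V.coeff b) + b * t) := by
    intro w hw a b; rw [hw.map_mul]; push_cast; ring
  have hkt : ∀ k : ℕ, (k : ℝ≥0∞) * t ≠ ⊤ := fun k => ENNReal.mul_ne_top (by simp) htop
  have hlt : ∀ a b : ℕ, a < i ∨ b < j → v + v' < ν (U.coeff a * V.coeff b) + (a + b : ℕ) * t := by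
    intro a b hab
    rw [aux ν hν]
    rcases hab with h | h
    · exact ENNReal.add_lt_add_of_lt_of_le hV.fin (hU.lt a h) (hVn b)
    · exact ENNReal.add_lt_add_of_le_of_lt hU.fin (hUn a) (hV.lt b h)
  refine ⟨by simp [hU.fin, hV.fin], ?_, ?_, ?_⟩
  · intro k
    rw [Polynomial.coeff_mul, ← tsub_le_iff_right]
    refine hμ.sum_le _ _ fun p hp => ?_
    rw [tsub_le_iff_right, ← Finset.HasAntidiagonal.mem_antidiagonal.1 hp, aux μ hμ]
    exact add_le_add (hU.le _) (hV.le _)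
  · have hmem : (i, j) ∈ Finset.HasAntidiagonal.antidiagonal (i + j) := by simp
    rw [Polynomial.coeff_mul, ← Finset.add_sum_erase _ _ hmem, hν.add_eq, aux ν hν, hU.eq, hV.eq]
    have e : ν (U.coeff i * V.coeff j) + (i + j : ℕ) * t = v + v' := by
      rw [aux ν hν, hU.eq, hV.eq]
    refine hν.sum_lt _ _ ?_ ?_
    · intro h
      rw [h, top_add] at e
      exact absurd e.symm (by simp [hU.fin, hV.fin])
    · rintro ⟨a, b⟩ hp
      rw [Finset.mem_erase, Finset.HasAntidiagonal.mem_antidiagonal] at hp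
      obtain ⟨hne, hab⟩ := hp
      simp only at hab
      have hor : a < i ∨ b < j := by
        by_contra hcon
        push Not at hcon
        apply hne
        simp only [Prod.mk.injEq]
        omega
      have := hlt a b hor
      rw [← e, hab] at this
      exact lt_of_add_lt_add_right this
  · intro k hk
    rw [Polynomial.coeff_mul]
    have : v + v' - k * t < ν (∑ p ∈ Finset.HasAntidiagonal.antidiagonal k, U.coeff p.1 * V.coeff p.2) ∨
      v + v' < k * t := by
      by_cases hkv : v + v' < k * t
      · exact Or.inr hkv
      · left
        push Not at hkv
        refine hν.sum_lt _ _ (ENNReal.sub_ne_top (by simp [hU.fin, hV.fin])) ?_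
        rintro ⟨a, b⟩ hp
        rw [Finset.HasAntidiagonal.mem_antidiagonal] at hp
        simp only at hp
        have := hlt a b (by omega)
        rw [hp] at this
        exact ENNReal.sub_lt_of_lt_add hkv this
    rcases this with h | h
    · by_cases hkv : k * t ≤ v + v'
      · have := ENNReal.add_lt_add_right (hkt k) h
        rwa [tsub_add_cancel_of_le hkv] at this
      · push Not at hkv
        exact lt_of_lt_of_le hkv le_add_self
    · exact lt_of_lt_of_le h le_add_self

include ht htop in
theorem Key.opt_exists {h : R} (hh : μ h ≠ ⊤) :
    ∃ U v i, Opt μ ν t U v i ∧ U.eval f = h := by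
  have key : ∀ (k : ℕ) (h : R), μ h < k * μ f → ∃ U v i, Opt μ ν t U v i ∧ U.eval f = h := by
    intro k
    induction k with
    | zero => intro h hh; simp at hh
    | succ k ih =>
      intro h hh
      obtain ⟨q, r, rfl, hr⟩ := K.div h
      by_cases hq : μ q < k * μ f
      · obtain ⟨V, v, i, hV, hVq⟩ := ih q hq
        have c0 : (V * X + C r).coeff 0 = r := by simp
        have cs : ∀ i, (V * X + C r).coeff (i + 1) = V.coeff i := by
          intro i; simp [Polynomial.coeff_C]
        have shift : ∀ (w : R → ℝ≥0∞) (i : ℕ), w ((V * X + C r).coeff (i + 1)) + (i + 1 : ℕ) * t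
          = w (V.coeff i) + i * t + t := by
          intro w i; rw [cs]; push_cast; ring
        rcases le_or_gt (ν r) (v + t) with hle | hgt
        · refine ⟨V * X + C r, ν r, 0, ⟨?_, ?_, ?_, ?_⟩, by simp [hVq]⟩
          · exact (lt_of_le_of_lt hle (by simp [lt_top_iff_ne_top, hV.fin, htop])).ne
          · intro i
            cases i with
            | zero => rw [c0, K.eqS r hr]; exact le_self_add
            | succ i => rw [shift]; exact hle.trans (by gcongr; exact hV.le i)
          · rw [c0]; simp
          · intro i hi; omega
        · refine ⟨V * X + C r, v + t, i + 1, ⟨by simp [hV.fin, htop], ?_, ?_, ?_⟩, by simp [hVq]⟩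
          · intro i
            cases i with
            | zero => rw [c0, K.eqS r hr]; exact hgt.le.trans le_self_add
            | succ i => rw [shift]; gcongr; exact hV.le i
          · rw [shift, hV.eq]
          · intro i hi
            cases i with
            | zero => rw [c0]; exact hgt.trans_le le_self_add
            | succ i =>
              rw [shift]
              exact ENNReal.add_lt_add_right htop (hV.lt i (by omega))
      · push Not at hq
        have h1 : ((k + 1 : ℕ) : ℝ≥0∞) * μ f ≤ μ (q * f) := by
          rw [K.hμ.map_mul]; push_cast; rw [add_mul, one_mul]; gcongr
        have h2 : μ r < (k + 1 : ℕ) * μ f := by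
          by_contra hc
          push Not at hc
          exact absurd ((le_min h1 hc).trans (K.hμ.add_ge _ _)) (not_le.2 hh)
        refine ⟨C q * X + C r, ν r, 0, ⟨?_, ?_, ?_, ?_⟩, by simp⟩
        · rw [← K.eqS r hr]; exact h2.ne_top
        · intro i
          rw [← K.eqS r hr]
          cases i with
          | zero => simp
          | succ i =>
            cases i with
            | zero =>
              have : (C q * X + C r).coeff (0 + 1) = q := by simp [Polynomial.coeff_C]
              rw [this]
              refine h2.le.trans ?_
              push_cast
              rw [add_mul, one_mul, one_mul]
              exact add_le_add hq ht.le
            | succ i =>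
              have : (C q * X + C r).coeff (i + 1 + 1) = 0 := by
                simp [Polynomial.coeff_C, Polynomial.coeff_X]
              rw [this, K.hμ.map_zero]; simp
        · simp
        · intro i hi; omega
  obtain ⟨n, hn⟩ := ENNReal.exists_nat_mul_gt K.pos.ne' hh
  exact key n h hn

include ht ht' htop in
theorem Key.aug_PV [IsDomain R] : PV (aug μ f t) := by
  refine ⟨?_, K.aug_add, ?_, ?_⟩
  · intro a b
    by_cases ha : μ a = ⊤
    · have h1 := K.aug_ge (t := t) a
      have h2 := K.aug_ge (t := t) (a * b)
      rw [K.hμ.map_mul] at h2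
      rw [ha, top_le_iff] at h1
      rw [ha, top_add, top_le_iff] at h2
      rw [h1, h2, top_add]
    by_cases hb : μ b = ⊤
    · have h1 := K.aug_ge (t := t) b
      have h2 := K.aug_ge (t := t) (a * b)
      rw [K.hμ.map_mul] at h2
      rw [hb, top_le_iff] at h1
      rw [hb, add_top, top_le_iff] at h2
      rw [h1, h2, add_top]
    obtain ⟨U, v, i, hU, rfl⟩ := K.opt_exists ht htop ha
    obtain ⟨V, v', j, hV, rfl⟩ := K.opt_exists ht htop hb
    rw [← Polynomial.eval_mul, K.opt_unique ht htop (hU.mul K.hν K.hμ K.le htop hV),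
      K.opt_unique ht htop hU, K.opt_unique ht htop hV]
  · exact le_antisymm (K.hν.map_one ▸ K.aug_le ht' 1) zero_le
  · exact top_le_iff.1 (K.hμ.map_zero ▸ K.aug_ge 0)

include ht htop in
theorem Key.aug_f [IsDomain R] : aug μ f t f = t := by
  have hX : Opt μ ν t (X : Polynomial R) t 1 := by
    refine ⟨htop, ?_, ?_, ?_⟩
    · intro i
      by_cases h : i = 1
      · subst h; simp
      · rw [Polynomial.coeff_X, if_neg (fun e => h e.symm), K.hμ.map_zero]; simp
    · simp [K.hν.map_one]
    · intro i hi
      have : i = 0 := by omega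
      subst this
      simp [K.hν.map_zero, lt_top_iff_ne_top, htop]
  have := K.opt_unique ht htop hX
  rwa [Polynomial.eval_X] at this

end aug

end VTree

namespace VTree

set_option linter.unusedSectionVars false

open scoped ENNReal

theorem order_aux {L : Type*} [LinearOrder L] (b : L) (hb : ∀ a, b ≤ a) (T : L)
    (hT : ∀ a, a ≤ T) (hbT : b < T) (hsup : ∀ A : Set L, ∃ s, IsLUB A s)
    (E : Set L) (hE : E.Countable) (hd : ∀ a c : L, a < c → ∃ d ∈ E, a < d ∧ d < c) :
    Nonempty (L ≃o EReal) := by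
  classical
  let E' : Set L := {d | d ∈ E ∧ b < d ∧ d < T}
  have hE' : E'.Countable := hE.mono fun d h => h.1
  have hd' : ∀ a c : L, a < c → ∃ d ∈ E', a < d ∧ d < c := by
    intro a c hac
    obtain ⟨d, h1, h2, h3⟩ := hd a c hac
    exact ⟨d, ⟨h1, (hb a).trans_lt h2, h3.trans_le (hT c)⟩, h2, h3⟩
  haveI : Countable E' := hE'.to_subtype
  haveI : DenselyOrdered E' := ⟨fun a c hac => by
    obtain ⟨d, h, h1, h2⟩ := hd' a c hac
    exact ⟨⟨d, h⟩, h1, h2⟩⟩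
  haveI : NoMinOrder E' := ⟨fun a => by
    obtain ⟨d, h, h1, h2⟩ := hd' b a a.2.2.1
    exact ⟨⟨d, h⟩, h2⟩⟩
  haveI : NoMaxOrder E' := ⟨fun a => by
    obtain ⟨d, h, h1, h2⟩ := hd' a T a.2.2.2
    exact ⟨⟨d, h⟩, h1⟩⟩
  haveI : Nonempty E' := by
    obtain ⟨d, h, h1, h2⟩ := hd' b T hbT
    exact ⟨⟨d, h⟩⟩
  obtain ⟨e⟩ := Order.iso_of_countable_dense ℚ E'
  let Φ : L → EReal := fun a => sSup {s : EReal | ∃ q : ℚ, ((e q : E') : L) ≤ a ∧ s = ((q : ℝ) : EReal)}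
  have hcast : ∀ p q : ℚ, ((p : ℝ) : EReal) < ((q : ℝ) : EReal) ↔ p < q := by
    intro p q
    rw [EReal.coe_lt_coe_iff]; exact_mod_cast Iff.rfl
  have helt : ∀ p q : ℚ, ((e p : E') : L) < (e q : E') ↔ p < q := by
    intro p q
    rw [Subtype.coe_lt_coe, e.lt_iff_lt]
  have hmono : StrictMono Φ := by
    intro a c hac
    obtain ⟨d1, h1, ha1, h1c⟩ := hd' a c hac
    obtain ⟨d2, h2, h12, h2c⟩ := hd' d1 c h1c
    obtain ⟨q1, hq1⟩ := e.surjective ⟨d1, h1⟩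
    obtain ⟨q2, hq2⟩ := e.surjective ⟨d2, h2⟩
    have hq : q1 < q2 := by rw [← helt, hq1, hq2]; exact h12
    have hA : Φ a ≤ ((q1 : ℝ) : EReal) := by
      refine sSup_le ?_
      rintro s ⟨q, hqa, rfl⟩
      have : q < q1 := by rw [← helt, hq1]; exact hqa.trans_lt ha1
      exact ((hcast _ _).2 this).le
    have hC : ((q2 : ℝ) : EReal) ≤ Φ c := by
      refine le_sSup ⟨q2, ?_, rfl⟩
      rw [hq2]; exact h2c.le
    exact (hA.trans_lt ((hcast _ _).2 hq)).trans_le hC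
  have hsurj : Function.Surjective Φ := by
    intro s
    obtain ⟨a, ha⟩ := hsup {l | ∃ q : ℚ, ((q : ℝ) : EReal) < s ∧ l = (e q : E')}
    refine ⟨a, le_antisymm ?_ ?_⟩
    · refine sSup_le ?_
      rintro _ ⟨q, hqa, rfl⟩
      by_contra hc
      push Not at hc
      obtain ⟨q', h1, h2⟩ := EReal.exists_rat_btwn_of_lt hc
      have h3 : ((e q' : E') : L) < a := ((helt _ _).2 ((hcast _ _).1 h2)).trans_le hqa
      obtain ⟨l, ⟨p, hp, rfl⟩, hl⟩ := (lt_isLUB_iff ha).1 h3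
      rw [helt] at hl
      exact lt_irrefl _ ((((hcast _ _).2 hl).trans hp).trans h1)
    · by_contra hc
      push Not at hc
      obtain ⟨q, h1, h2⟩ := EReal.exists_rat_btwn_of_lt hc
      have : ((q : ℝ) : EReal) ≤ Φ a := le_sSup ⟨q, ha.1 ⟨q, h2, rfl⟩, rfl⟩
      exact absurd this (not_le.2 h1)
  exact ⟨hmono.orderIsoOfSurjective Φ hsurj⟩

section

variable {R : Type*} [CommRing R] [IsLocalRing R]

/-- values in `[0,∞]` -/
noncomputable def vv (ν : ValSpace R) (f : R) : ℝ≥0∞ := (ν.1.v f).toENNReal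

theorem coe_vv (ν : ValSpace R) (f : R) : ((vv ν f : ℝ≥0∞) : EReal) = ν.1.v f :=
  EReal.coe_toENNReal (ν.1.nonneg f)

theorem le_iff {μ ν : ValSpace R} : μ ≤ ν ↔ ∀ f, vv μ f ≤ vv ν f := by
  change (∀ f, μ.1.v f ≤ ν.1.v f) ↔ _
  simp only [← coe_vv, EReal.coe_ennreal_le_coe_ennreal_iff]

theorem vv_ext {μ ν : ValSpace R} (h : ∀ f, vv μ f = vv ν f) : μ = ν :=
  le_antisymm (le_iff.2 fun f => (h f).le) (le_iff.2 fun f => (h f).ge)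

theorem coe_min' (a b : ℝ≥0∞) : ((min a b : ℝ≥0∞) : EReal) = min (a : EReal) b :=
  Monotone.map_min (f := fun a : ℝ≥0∞ => (a : EReal))
    fun a b h => EReal.coe_ennreal_le_coe_ennreal_iff.2 h

theorem vv_PV (ν : ValSpace R) : PV (vv ν) := by
  have hmul : ∀ f g, vv ν (f * g) = vv ν f + vv ν g := by
    intro f g
    rw [vv, ν.1.map_mul, EReal.toENNReal_add (ν.1.nonneg f) (ν.1.nonneg g)]; rfl
  refine ⟨hmul, ?_, ?_, ?_⟩
  · intro f g
    rw [← EReal.coe_ennreal_le_coe_ennreal_iff, coe_min', coe_vv, coe_vv, coe_vv]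
    exact ν.1.add_ge f g
  · rw [vv, ν.1.map_one]; simp
  · obtain ⟨g, hg, -⟩ := ν.1.proper
    have hp : vv ν g ≠ 0 := by
      have := ν.1.pos g hg
      rw [← coe_vv] at this
      intro h
      rw [h] at this
      simp at this
    have h0 := hmul 0 g
    rw [zero_mul] at h0
    by_contra hne
    exact hp ((ENNReal.add_right_inj hne).1 (by rw [add_zero]; exact h0.symm))

theorem vv_ge_one (ν : ValSpace R) {f : R} (hf : f ∈ maximalIdeal R) : 1 ≤ vv ν f := by
  have h := ν.2
  unfold CenteredValn.Normalized at h
  have : (1 : EReal) ≤ ν.1.v f := by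
    rw [← h]; exact sInf_le ⟨f, hf, rfl⟩
  rw [← coe_vv] at this
  exact_mod_cast this

theorem ge_min {w : R → ℝ≥0∞} (hw : PV w) {x y f : R} (hm : maximalIdeal R = Ideal.span {x, y})
    (hf : f ∈ maximalIdeal R) : min (w x) (w y) ≤ w f := by
  rw [hm, Ideal.mem_span_pair] at hf
  obtain ⟨a, b, rfl⟩ := hf
  refine le_trans (min_le_min ?_ ?_) (hw.add_ge _ _) <;>
  · rw [hw.map_mul]; exact le_add_self

theorem vv_le_one (ν : ValSpace R) {x y : R} (hm : maximalIdeal R = Ideal.span {x, y}) :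
    vv ν x ≤ 1 ∨ vv ν y ≤ 1 := by
  rw [← min_le_iff]
  have h := ν.2
  unfold CenteredValn.Normalized at h
  have : ((min (vv ν x) (vv ν y) : ℝ≥0∞) : EReal) ≤ 1 := by
    rw [← h]
    refine le_sInf ?_
    rintro _ ⟨f, hf, rfl⟩
    rw [← coe_vv, EReal.coe_ennreal_le_coe_ennreal_iff]
    exact ge_min (vv_PV ν) hm hf
  exact_mod_cast this

theorem mkV {x y : R} (hm : maximalIdeal R = Ideal.span {x, y}) (w : R → ℝ≥0∞) (hw : PV w)
    (hx : 1 ≤ w x) (hy : 1 ≤ w y) (h1 : w x ≤ 1 ∨ w y ≤ 1) :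
    ∃ ν : ValSpace R, ∀ f, vv ν f = w f := by
  have hxm : x ∈ maximalIdeal R := by rw [hm]; exact Ideal.subset_span (by simp)
  have hym : y ∈ maximalIdeal R := by rw [hm]; exact Ideal.subset_span (by simp)
  have hge : ∀ f ∈ maximalIdeal R, 1 ≤ w f := fun f hf => (le_min hx hy).trans (ge_min hw hm hf)
  have hex : ∃ z ∈ maximalIdeal R, w z = 1 := by
    rcases h1 with h | h
    · exact ⟨x, hxm, le_antisymm h hx⟩
    · exact ⟨y, hym, le_antisymm h hy⟩
  let V : CenteredValn R :=
    { v := fun f => (w f : EReal)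
      map_mul := fun f g => by rw [hw.map_mul, EReal.coe_ennreal_add]
      add_ge := fun f g => by
        rw [← coe_min', EReal.coe_ennreal_le_coe_ennreal_iff]; exact hw.add_ge f g
      map_one := by rw [hw.map_one]; simp
      nonneg := fun f => EReal.coe_ennreal_nonneg _
      pos := fun f hf => by
        have : (0 : ℝ≥0∞) < w f := lt_of_lt_of_le one_pos (hge f hf)
        exact_mod_cast this
      proper := by
        obtain ⟨z, hz, h⟩ := hex
        exact ⟨z, hz, by rw [h]; exact EReal.coe_ennreal_eq_top_iff.not.2 ENNReal.one_ne_top⟩ }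
  refine ⟨⟨V, ?_⟩, fun f => ?_⟩
  · unfold CenteredValn.Normalized
    apply le_antisymm
    · obtain ⟨z, hz, h⟩ := hex
      exact sInf_le ⟨z, hz, by change (w z : EReal) = 1; rw [h]; simp⟩
    · refine le_sInf ?_
      rintro _ ⟨f, hf, rfl⟩
      change (1 : EReal) ≤ (w f : EReal)
      exact_mod_cast hge f hf
  · change ((w f : EReal)).toENNReal = w f
    simp

/-- suprema of chains -/
theorem chain_sup {x y : R} (hm : maximalIdeal R = Ideal.span {x, y})
    (A : Set (ValSpace R)) (hA : A.Nonempty) (hc : IsChain (· ≤ ·) A) :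
    ∃ σ : ValSpace R, IsLUB A σ := by
  have hxm : x ∈ maximalIdeal R := by rw [hm]; exact Ideal.subset_span (by simp)
  have hym : y ∈ maximalIdeal R := by rw [hm]; exact Ideal.subset_span (by simp)
  obtain ⟨a, ha⟩ := hA
  let w : R → ℝ≥0∞ := fun f => ⨆ μ : A, vv μ.1 f
  have hle : ∀ μ ∈ A, ∀ f, vv μ f ≤ w f := fun μ hμ f => le_iSup (fun μ : A => vv μ.1 f) ⟨μ, hμ⟩
  have hdir : ∀ μ ν : A, ∃ κ : A, μ.1 ≤ κ.1 ∧ ν.1 ≤ κ.1 := by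
    intro μ ν
    rcases hc.total μ.2 ν.2 with h | h
    · exact ⟨ν, h, le_rfl⟩
    · exact ⟨μ, le_rfl, h⟩
  have hpv : PV w := by
    refine ⟨?_, ?_, ?_, ?_⟩
    · intro f g
      change (⨆ μ : A, vv μ.1 (f * g)) = (⨆ μ : A, vv μ.1 f) + (⨆ μ : A, vv μ.1 g)
      rw [ENNReal.iSup_add_iSup]
      · exact iSup_congr fun μ => (vv_PV μ.1).map_mul f g
      · intro μ ν
        obtain ⟨κ, h1, h2⟩ := hdir μ ν
        exact ⟨κ, add_le_add (le_iff.1 h1 f) (le_iff.1 h2 g)⟩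
    · intro f g
      refine le_of_forall_lt fun c hlt => ?_
      obtain ⟨h1, h2⟩ := lt_min_iff.1 hlt
      obtain ⟨μ, h1⟩ := lt_iSup_iff.1 h1
      obtain ⟨ν, h2⟩ := lt_iSup_iff.1 h2
      obtain ⟨κ, h3, h4⟩ := hdir μ ν
      refine lt_of_lt_of_le (lt_min (h1.trans_le (le_iff.1 h3 f)) (h2.trans_le (le_iff.1 h4 g))) ?_
      exact ((vv_PV κ.1).add_ge f g).trans (hle κ.1 κ.2 _)
    · refine le_antisymm (iSup_le fun μ => ?_) zero_le
      rw [(vv_PV μ.1).map_one]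
    · exact top_le_iff.1 ((vv_PV a).map_zero ▸ hle a ha 0)
  obtain ⟨σ, hσ⟩ := mkV hm w hpv ((vv_ge_one a hxm).trans (hle a ha x))
    ((vv_ge_one a hym).trans (hle a ha y)) (by
      by_contra hcon
      push Not at hcon
      obtain ⟨h1, h2⟩ := hcon
      obtain ⟨μ, h1⟩ := lt_iSup_iff.1 h1
      obtain ⟨ν, h2⟩ := lt_iSup_iff.1 h2
      obtain ⟨κ, h3, h4⟩ := hdir μ ν
      rcases vv_le_one κ.1 hm with h | h
      · exact absurd (h1.trans_le (le_iff.1 h3 x)) (not_lt.2 h)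
      · exact absurd (h2.trans_le (le_iff.1 h4 y)) (not_lt.2 h))
  refine ⟨σ, fun μ hμ => le_iff.2 fun f => (hσ f).symm ▸ hle μ hμ f, fun ρ hρ => le_iff.2 fun f => ?_⟩
  rw [hσ]
  exact iSup_le fun μ => le_iff.1 (hρ μ.2) f

end

section

variable {R : Type*} [CommRing R] [IsDomain R] [IsNoetherianRing R] [IsLocalRing R] {x y : R}

/-- `f` is of minimal degree `n` with `μ f < ν f`. -/
structure Min (x y : R) (μ ν : ValSpace R) (n : ℕ) (f : R) : Prop where
  hD : D x y n f
  lt : vv μ f < vv ν f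
  small : ∀ l < n, ∀ r, D x y l r → vv μ r = vv ν r

theorem vx_eq (P : Par x y) {μ ν : ValSpace R} (h : μ ≤ ν) (hx : vv ν x = 1) : vv μ x = 1 :=
  le_antisymm (hx ▸ le_iff.1 h x) (vv_ge_one μ P.xm)

theorem small_eq {μ ν : ValSpace R} {n : ℕ} (hx : vv μ x = vv ν x)
    (h : ∀ l < n, ∀ r, D x y l r → vv μ r = vv ν r) {r : R} (hr : Small x y n r) :
    vv μ r = vv ν r := by
  rcases hr with rfl | ⟨j, l, r', rfl, hl, hD⟩
  · rw [(vv_PV μ).map_zero, (vv_PV ν).map_zero]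
  · rw [(vv_PV μ).map_mul, (vv_PV ν).map_mul, (vv_PV μ).map_pow, (vv_PV ν).map_pow, hx,
      h l hl r' hD]

theorem Min.pos (P : Par x y) {μ ν : ValSpace R} {n : ℕ} {f : R} (M : Min x y μ ν n f) :
    0 < n := by
  rcases Nat.eq_zero_or_pos n with rfl | h
  · have := M.lt
    rw [(vv_PV μ).map_unit (P.D_zero_unit M.hD), (vv_PV ν).map_unit (P.D_zero_unit M.hD)] at this
    exact absurd this (lt_irrefl _)
  · exact h

theorem Min.key (P : Par x y) {μ ν : ValSpace R} (h : μ ≤ ν) (hx : vv ν x = 1) {n : ℕ} {f : R}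
    (M : Min x y μ ν n f) : Key (vv μ) (vv ν) {r | Small x y n r} f where
  hμ := vv_PV μ
  hν := vv_PV ν
  le := le_iff.1 h
  lt := M.lt
  pos := lt_of_lt_of_le one_pos (vv_ge_one μ (P.D_mem (M.pos P) M.hD))
  eqS := fun r hr => small_eq ((vx_eq P h hx).trans hx.symm) M.small hr
  div := P.division M.hD

theorem exists_Min (P : Par x y) {μ ν : ValSpace R} (h : μ ≤ ν) (hx : vv ν x = 1) (hne : μ ≠ ν) :
    ∃ n f, Min x y μ ν n f := by
  classical
  have hex : ∃ n f, D x y n f ∧ vv μ f < vv ν f := by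
    by_contra hcon
    push Not at hcon
    apply hne
    apply vv_ext
    intro g
    by_cases hg : g = 0
    · rw [hg, (vv_PV μ).map_zero, (vv_PV ν).map_zero]
    obtain ⟨j, l, f, rfl, hf⟩ := P.strip hg
    rw [(vv_PV μ).map_mul, (vv_PV ν).map_mul, (vv_PV μ).map_pow, (vv_PV ν).map_pow, hx,
      vx_eq P h hx, le_antisymm (le_iff.1 h f) (hcon l f hf)]
  obtain ⟨f, hf, hlt⟩ := Nat.find_spec hex
  refine ⟨Nat.find hex, f, hf, hlt, fun l hl r hr => ?_⟩
  have := Nat.find_min hex hl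
  push Not at this
  exact le_antisymm (le_iff.1 h r) (this r hr)

theorem min_compare (P : Par x y) {μ μ' ν : ValSpace R} (h : μ ≤ ν) (h' : μ' ≤ ν)
    (hx : vv ν x = 1) {n : ℕ} {f : R} (M : Min x y μ ν n f)
    (hs : ∀ l < n, ∀ r, D x y l r → vv μ' r = vv ν r) (hf : vv μ f ≤ vv μ' f) : μ ≤ μ' := by
  refine le_iff.2 ((M.key P h hx).compare (vv_PV μ') ?_ hf)
  intro r hr
  rw [small_eq ((vx_eq P h hx).trans hx.symm) M.small hr,
    small_eq ((vx_eq P h' hx).trans hx.symm) hs hr]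

theorem total_aux (P : Par x y) {μ μ' ν : ValSpace R} (h : μ ≤ ν) (h' : μ' ≤ ν)
    (hx : vv ν x = 1) {n n' : ℕ} {f f' : R} (M : Min x y μ ν n f) (M' : Min x y μ' ν n' f')
    (hn : n ≤ n') : μ ≤ μ' ∨ μ' ≤ μ := by
  have hs : ∀ l < n, ∀ r, D x y l r → vv μ' r = vv ν r := fun l hl => M'.small l (hl.trans_le hn)
  rcases le_or_gt (vv μ f) (vv μ' f) with hf | hf
  · exact Or.inl (min_compare P h h' hx M hs hf)
  · right
    have M2 : Min x y μ' ν n f := ⟨M.hD, hf.trans M.lt, hs⟩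
    exact min_compare P h' h hx M2 M.small hf.le

theorem total (P : Par x y) {μ μ' ν : ValSpace R} (h : μ ≤ ν) (h' : μ' ≤ ν)
    (hx : vv ν x = 1) : μ ≤ μ' ∨ μ' ≤ μ := by
  by_cases h1 : μ = ν
  · right; rw [h1]; exact h'
  by_cases h2 : μ' = ν
  · left; rw [h2]; exact h
  obtain ⟨n, f, M⟩ := exists_Min P h hx h1
  obtain ⟨n', f', M'⟩ := exists_Min P h' hx h2
  rcases le_total n n' with hn | hn
  · exact total_aux P h h' hx M M' hn
  · exact (total_aux P h' h hx M' M hn).symm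

/-- the value at a minimal element does not depend on the element -/
theorem min_value (P : Par x y) {μ ν : ValSpace R} (h : μ ≤ ν)
    (hx : vv ν x = 1) {n : ℕ} {f g : R} (M : Min x y μ ν n f) (hg : D x y n g) :
    vv μ g ≤ vv μ f := by
  obtain ⟨q, r, rfl, hr⟩ := P.division M.hD g
  refine ((M.key P h hx).le_q q hr).trans ?_
  have hq : IsUnit q := by
    have hxr : x ∣ r := by
      rcases hr with rfl | ⟨j, l, r', rfl, hl, hD⟩
      · exact dvd_zero x
      · cases j with
        | succ j => exact ⟨x ^ j * r', by ring⟩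
        | zero =>
          exfalso
          obtain ⟨u, a, hu, e⟩ := hg
          obtain ⟨u', a', hu', e'⟩ := M.hD
          have := P.D_le hD (l := n) (c := u - q * u') (a := a - q * a') (by
            rw [pow_zero, one_mul] at e
            rw [e'] at e
            linear_combination e)
          omega
    obtain ⟨c, rfl⟩ := hxr
    have hxq : ¬ x ∣ q := by
      rintro ⟨d, rfl⟩
      exact P.D_not_dvd hg ⟨d * f + c, by ring⟩
    obtain ⟨k, hk⟩ := P.D_exists hxq
    have h1 := D_mul hk M.hD
    have h2 : D x y (k + n) (q * f + x * c) := by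
      obtain ⟨u, a, hu, e⟩ := h1
      exact ⟨u, a + c, hu, by rw [e]; ring⟩
    have h3 := P.D_unique hg h2
    have : k = 0 := by omega
    subst this
    exact P.D_zero_unit hk
  rw [(vv_PV μ).map_unit hq, zero_add]

theorem min_inj (P : Par x y) {μ μ' ν : ValSpace R} (h : μ ≤ ν) (h' : μ' ≤ ν) (hμ : μ ≤ μ')
    (hx : vv ν x = 1) {n : ℕ} {f f' : R} (M : Min x y μ ν n f) (M' : Min x y μ' ν n f')
    (heq : vv μ f = vv μ' f') : μ = μ' := by
  have M2 : Min x y μ ν n f' := ⟨M'.hD, (le_iff.1 hμ f').trans_lt M'.lt, M.small⟩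
  have e : vv μ f = vv μ f' := le_antisymm (min_value P h hx M2 M.hD) (min_value P h hx M M2.hD)
  exact le_antisymm hμ (min_compare P h' h hx M' M.small (by rw [← heq, e]))

theorem between (P : Par x y) {μ μ' ν : ValSpace R} (hμ : μ < μ') (h' : μ' ≤ ν)
    (hx : vv ν x = 1) {E : Set ℝ≥0∞} (hE : Dense E) :
    ∃ (ρ : ValSpace R) (n : ℕ) (f : R), μ < ρ ∧ ρ < μ' ∧ Min x y ρ ν n f ∧ vv ρ f ∈ E := by
  have h : μ ≤ ν := hμ.le.trans h'
  obtain ⟨n, f, M⟩ := exists_Min P h hx (hμ.trans_le h').ne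
  have hs : ∀ l < n, ∀ r, D x y l r → vv μ' r = vv ν r := fun l hl r hr =>
    le_antisymm (le_iff.1 h' r) (M.small l hl r hr ▸ le_iff.1 hμ.le r)
  have hlt : vv μ f < vv μ' f := by
    by_contra hc
    push Not at hc
    have M2 : Min x y μ' ν n f := ⟨M.hD, hc.trans_lt M.lt, hs⟩
    exact absurd (min_compare P h' h hx M2 M.small hc) (not_le_of_gt hμ)
  have hx' : vv μ' x = 1 := vx_eq P h' hx
  have M1 : Min x y μ μ' n f := ⟨M.hD, hlt, fun l hl r hr => by
    rw [M.small l hl r hr, hs l hl r hr]⟩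
  have K := M1.key P hμ.le hx'
  obtain ⟨t, htE, ht1, ht2⟩ := hE.exists_between hlt
  have htop : t ≠ ⊤ := ht2.ne_top
  have hxle : aug (vv μ) f t x ≤ 1 := hx' ▸ K.aug_le ht2.le x
  obtain ⟨ρ, hρ⟩ := mkV P.hm (aug (vv μ) f t) (K.aug_PV ht1 ht2.le htop)
    ((vv_ge_one μ P.xm).trans (K.aug_ge x)) ((vv_ge_one μ P.ym).trans (K.aug_ge y)) (Or.inl hxle)
  have hρf : vv ρ f = t := by rw [hρ, K.aug_f ht1 htop]
  have l1 : μ ≤ ρ := le_iff.2 fun g => by rw [hρ]; exact K.aug_ge g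
  have l2 : ρ ≤ μ' := le_iff.2 fun g => by rw [hρ]; exact K.aug_le ht2.le g
  refine ⟨ρ, n, f, lt_of_le_of_ne l1 ?_, lt_of_le_of_ne l2 ?_, ⟨M.hD, ?_, ?_⟩, ?_⟩
  · rintro rfl; exact ht1.ne hρf
  · rintro rfl; exact ht2.ne hρf.symm
  · rw [hρf]; exact ht2.trans_le (le_iff.1 h' f)
  · intro l hl r hr
    exact le_antisymm (le_iff.1 (l2.trans h') r) (M.small l hl r hr ▸ le_iff.1 l1 r)
  · rw [hρf]; exact htE

end

end VTree

namespace VTree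

open scoped ENNReal

section

variable {R : Type*} [CommRing R] [IsDomain R] [IsNoetherianRing R] [IsLocalRing R] {x y : R}

/-- multiplicity with values in `[0,∞]` -/
noncomputable def mv (f : R) : ℝ≥0∞ := ⨆ (i : ℕ) (_ : f ∈ maximalIdeal R ^ i), (i : ℝ≥0∞)

theorem cast_ennreal_nat (i : ℕ) : (((i : ℕ) : ℝ≥0∞) : EReal) = (i : EReal) := by
  induction i with
  | zero => simp
  | succ i ih => rw [Nat.cast_succ, Nat.cast_succ, EReal.coe_ennreal_add, ih, EReal.coe_ennreal_one]

theorem coe_mv (f : R) : ((mv f : ℝ≥0∞) : EReal) = multVal R f := by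
  have hle : ∀ i : ℕ, f ∈ maximalIdeal R ^ i → (i : EReal) ≤ multVal R f :=
    fun i hi => le_sSup ⟨i, hi, rfl⟩
  have h0 : 0 ≤ multVal R f := by
    have := hle 0 (by simp)
    simpa using this
  apply le_antisymm
  · rw [← EReal.coe_toENNReal h0, EReal.coe_ennreal_le_coe_ennreal_iff]
    refine iSup₂_le fun i hi => ?_
    rw [← EReal.coe_ennreal_le_coe_ennreal_iff, EReal.coe_toENNReal h0]
    rw [cast_ennreal_nat]
    exact hle i hi
  · refine sSup_le ?_
    rintro _ ⟨i, hi, rfl⟩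
    have : (i : ℝ≥0∞) ≤ mv f := le_iSup₂_of_le i hi le_rfl
    rw [← EReal.coe_ennreal_le_coe_ennreal_iff] at this
    rw [cast_ennreal_nat] at this
    exact this

theorem mv_exact {f : R} {i : ℕ} (h : f ∈ maximalIdeal R ^ i) (h' : f ∉ maximalIdeal R ^ (i + 1)) :
    mv f = i := by
  apply le_antisymm
  · refine iSup₂_le fun j hj => ?_
    have : j ≤ i := by
      by_contra hc
      push Not at hc
      exact h' (Ideal.pow_le_pow_right hc hj)
    exact_mod_cast this
  · exact le_iSup₂_of_le i h le_rfl

theorem mv_top {f : R} (h : ∀ i, f ∈ maximalIdeal R ^ i) : mv f = ⊤ := by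
  refine ENNReal.eq_top_of_forall_nnreal_le fun r => ?_
  obtain ⟨n, hn⟩ := exists_nat_ge r
  refine le_trans ?_ (le_iSup₂_of_le n (h n) le_rfl)
  exact_mod_cast hn

theorem mv_cases (f : R) : (∀ i, f ∈ maximalIdeal R ^ i) ∨
    ∃ i, f ∈ maximalIdeal R ^ i ∧ f ∉ maximalIdeal R ^ (i + 1) := by
  by_contra hcon
  push Not at hcon
  obtain ⟨⟨i, hi⟩, h⟩ := hcon
  apply hi
  clear hi
  induction i with
  | zero => simp
  | succ i ih => exact h i ih

theorem mv_PV (P : Par x y) : PV (mv : R → ℝ≥0∞) := by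
  refine ⟨?_, ?_, ?_, mv_top fun i => zero_mem _⟩
  · intro f g
    rcases mv_cases f with hf | ⟨i, hi, hi'⟩
    · rw [mv_top hf, mv_top fun i => Ideal.mul_mem_right _ _ (hf i), top_add]
    rcases mv_cases g with hg | ⟨j, hj, hj'⟩
    · rw [mv_top hg, mv_top fun i => Ideal.mul_mem_left _ _ (hg i), add_top]
    rw [mv_exact hi hi', mv_exact hj hj', mv_exact (i := i + j) _
      (P.gr_domain (i + j) i j f g rfl hi hi' hj hj')]
    · push_cast; rfl
    · rw [pow_add]; exact Ideal.mul_mem_mul hi hj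
  · intro f g
    refine le_of_forall_lt fun c hc => ?_
    obtain ⟨h1, h2⟩ := lt_min_iff.1 hc
    simp only [mv, lt_iSup_iff] at h1 h2
    obtain ⟨i, hi, h1⟩ := h1
    obtain ⟨j, hj, h2⟩ := h2
    have : f + g ∈ maximalIdeal R ^ (min i j) :=
      Ideal.add_mem _ (Ideal.pow_le_pow_right (min_le_left _ _) hi)
        (Ideal.pow_le_pow_right (min_le_right _ _) hj)
    refine lt_of_lt_of_le ?_ (le_iSup₂_of_le (min i j) this le_rfl)
    rcases min_choice i j with h | h <;> rw [h] <;> assumption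
  · have := mv_exact (f := (1 : R)) (i := 0) (by simp) (by
      rw [zero_add, pow_one]
      exact fun h => (mem_maximalIdeal _).1 h isUnit_one)
    simpa using this

theorem mv_x (P : Par x y) : mv x = 1 := by
  have := mv_exact (f := x) (i := 1) (by rw [pow_one]; exact P.xm) (by
    intro h
    have h1 := P.cancel_x (h := 1) (N := 1) (by rwa [mul_one])
    rw [pow_one] at h1
    exact (mem_maximalIdeal _).1 h1 isUnit_one)
  simpa using this

theorem mv_le (μ : ValSpace R) (f : R) : mv f ≤ vv μ f := by
  refine iSup₂_le fun i => ?_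
  induction i generalizing f with
  | zero => intro _; simp
  | succ i ih =>
    intro hi
    rw [pow_succ] at hi
    refine Submodule.mul_induction_on hi ?_ ?_
    · intro a ha b hb
      rw [(vv_PV μ).map_mul]
      push_cast
      exact add_le_add (ih a ha) (vv_ge_one μ hb)
    · intro a b ha hb
      exact (le_min ha hb).trans ((vv_PV μ).add_ge a b)

theorem exists_root (P : Par x y) (P' : Par y x) : ∃ ν₀ : ValSpace R,
    (∀ f : R, ν₀.1.v f = multVal R f) ∧ ∀ μ, ν₀ ≤ μ := by
  obtain ⟨ν, hν⟩ := mkV P.hm mv (mv_PV P) (mv_x P).ge (mv_x P').ge (Or.inl (mv_x P).le)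
  refine ⟨ν, fun f => ?_, fun μ => le_iff.2 fun f => ?_⟩
  · rw [← coe_vv, hν, coe_mv]
  · rw [hν]; exact mv_le μ f

theorem segment (P : Par x y) (ν₀ : ValSpace R) (h₀ : ∀ μ, ν₀ ≤ μ) (ν : ValSpace R)
    (hx : vv ν x = 1) :
    ∃ I : Set EReal, I.OrdConnected ∧ Nonempty ({μ : ValSpace R // μ ≤ ν} ≃o I) := by
  classical
  by_cases hν : ν = ν₀
  · refine ⟨{0}, Set.ordConnected_singleton, ?_⟩
    haveI : Unique {μ : ValSpace R // μ ≤ ν} :=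
      ⟨⟨⟨ν, le_rfl⟩⟩, fun μ => Subtype.ext (le_antisymm μ.2 (hν ▸ h₀ μ.1))⟩
    exact ⟨OrderIso.ofUnique _ _⟩
  refine ⟨Set.univ, Set.ordConnected_univ, ?_⟩
  letI : LinearOrder {μ : ValSpace R // μ ≤ ν} :=
    { (inferInstance : PartialOrder {μ : ValSpace R // μ ≤ ν}) with
      le_total := fun a b => total P a.2 b.2 hx
      toDecidableLE := Classical.decRel _ }
  obtain ⟨E, hEc, hEd⟩ := TopologicalSpace.exists_countable_dense ℝ≥0∞
  have main : Nonempty ({μ : ValSpace R // μ ≤ ν} ≃o EReal) := by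
    refine order_aux (⟨ν₀, h₀ ν⟩ : {μ : ValSpace R // μ ≤ ν}) (fun a => h₀ a.1) ⟨ν, le_rfl⟩
      (fun a => a.2) ?_ ?_
      {ρ | ∃ n f, Min x y ρ.1 ν n f ∧ vv ρ.1 f ∈ E} ?_ ?_
    · exact lt_of_le_of_ne (h₀ ν) fun h => hν (congrArg Subtype.val h).symm
    · intro A
      rcases A.eq_empty_or_nonempty with rfl | hA
      · exact ⟨⟨ν₀, h₀ ν⟩, by simp [upperBounds], fun a _ => h₀ a.1⟩
      · obtain ⟨σ, hσ⟩ := chain_sup P.hm (Subtype.val '' A) (hA.image _) (by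
          rintro _ ⟨a, _, rfl⟩ _ ⟨b, _, rfl⟩ _
          exact total P a.2 b.2 hx)
        refine ⟨⟨σ, hσ.2 ?_⟩, ?_, ?_⟩
        · rintro _ ⟨a, _, rfl⟩; exact a.2
        · intro a ha; exact hσ.1 ⟨a, ha, rfl⟩
        · intro b hb
          refine hσ.2 ?_
          rintro _ ⟨a, ha, rfl⟩; exact hb ha
    · rw [← Set.countable_coe_iff]
      haveI : Countable E := hEc.to_subtype
      have hex : ∀ ρ : {ρ : {μ : ValSpace R // μ ≤ ν} | ∃ n f, Min x y ρ.1 ν n f ∧ vv ρ.1 f ∈ E},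
        ∃ n f, Min x y ρ.1.1 ν n f ∧ vv ρ.1.1 f ∈ E := fun ρ => ρ.2
      choose n f hM hf using hex
      refine Function.Injective.countable (β := ℕ × E) (f := fun ρ => (n ρ, ⟨_, hf ρ⟩)) ?_
      intro a b hab
      simp only [Prod.mk.injEq, Subtype.mk.injEq] at hab
      have Mb := hM b
      rw [← hab.1] at Mb
      apply Subtype.ext
      apply Subtype.ext
      rcases total P a.1.2 b.1.2 hx with h | h
      · exact min_inj P a.1.2 b.1.2 h hx (hM a) Mb hab.2
      · exact (min_inj P b.1.2 a.1.2 h hx Mb (hM a) hab.2.symm).symm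
    · intro a c hac
      have hac' : a.1 < c.1 := hac
      obtain ⟨ρ, n, f, h1, h2, h3, h4⟩ := between P hac' c.2 hx hEd
      exact ⟨⟨ρ, h2.le.trans c.2⟩, ⟨n, f, h3, h4⟩, h1, h2⟩
  obtain ⟨e⟩ := main
  exact ⟨e.trans OrderIso.Set.univ.symm⟩

end

end VTree
/-- For a regular local ring `(R,𝔪)` of Krull dimension 2, the poset
`𝒱` is a complete nonmetric tree rooted at the multiplicity valuation `ν_𝔪`:
(i) `ν_𝔪 : f ↦ sup {i : f ∈ 𝔪^i}` is the unique smallest element of `𝒱`;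
(ii) for every `ν ∈ 𝒱` the set `{μ : μ ≤ ν}` is order-isomorphic to an interval
(an order-convex subset) of `ℝ ∪ {∞}` (the extended real line);
(iii) every nonempty totally ordered convex subset of `𝒱` is order-isomorphic to such
an interval; (iv) every nonempty subset of `𝒱` has an infimum in `𝒱`;
(v) every increasing sequence in `𝒱` has an upper bound in `𝒱`. -/
theorem valuation_space_is_complete_tree
    (R : Type*) [CommRing R] [IsDomain R] [IsNoetherianRing R] [IsLocalRing R]
    (hdim : ringKrullDim R = 2)
    (hreg : ∃ x y : R, maximalIdeal R = Ideal.span {x, y}) :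
    -- (i) the multiplicity valuation is the unique smallest element of 𝒱
    (∃ ν₀ : ValSpace R, (∀ f : R, ν₀.1.v f = multVal R f) ∧ (∀ μ : ValSpace R, ν₀ ≤ μ) ∧
      ∀ ν₁ : ValSpace R, (∀ μ : ValSpace R, ν₁ ≤ μ) → ν₁ = ν₀) ∧
    -- (ii) subtrees below a point are order-isomorphic to intervals of ℝ ∪ {∞}
    (∀ ν : ValSpace R, ∃ I : Set EReal, I.OrdConnected ∧
      Nonempty ({μ : ValSpace R // μ ≤ ν} ≃o I)) ∧
    -- (iii) nonempty totally ordered convex subsets are order-isomorphic to intervals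
    (∀ S : Set (ValSpace R), S.Nonempty → IsChain (· ≤ ·) S →
      (∀ μ ∈ S, ∀ ν ∈ S, ∀ ρ : ValSpace R, μ ≤ ρ → ρ ≤ ν → ρ ∈ S) →
      ∃ I : Set EReal, I.OrdConnected ∧ Nonempty (S ≃o I)) ∧
    -- (iv) every nonempty subset has an infimum
    (∀ S : Set (ValSpace R), S.Nonempty → ∃ ρ : ValSpace R, IsGLB S ρ) ∧
    -- (v) every increasing sequence has an upper bound
    (∀ c : ℕ → ValSpace R, Monotone c → ∃ b : ValSpace R, ∀ n, c n ≤ b) := by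
  obtain ⟨a, b, hab⟩ := hreg
  have hab' : maximalIdeal R = Ideal.span {b, a} := by rw [hab, Set.pair_comm]
  have P := VTree.mkPar hdim hab
  have P' := VTree.mkPar hdim hab'
  have hpar : ∀ ν : ValSpace R, ∃ x y : R, VTree.Par x y ∧ VTree.vv ν x = 1 := by
    intro ν
    rcases VTree.vv_le_one ν hab with h | h
    · exact ⟨a, b, P, le_antisymm h (VTree.vv_ge_one ν P.xm)⟩
    · exact ⟨b, a, P', le_antisymm h (VTree.vv_ge_one ν P.ym)⟩
  obtain ⟨ν₀, hm, h₀⟩ := VTree.exists_root P P'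
  have hii : ∀ ν : ValSpace R, ∃ I : Set EReal, I.OrdConnected ∧
      Nonempty ({μ : ValSpace R // μ ≤ ν} ≃o I) := by
    intro ν
    obtain ⟨x, y, Q, hx⟩ := hpar ν
    exact VTree.segment Q ν₀ h₀ ν hx
  refine ⟨⟨ν₀, hm, h₀, fun ν₁ h₁ => le_antisymm (h₁ ν₀) (h₀ ν₁)⟩, hii, ?_, ?_, ?_⟩
  · intro S hS hchain hconv
    obtain ⟨σ, hσ⟩ := VTree.chain_sup hab S hS hchain
    obtain ⟨I, hI, ⟨e⟩⟩ := hii σ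
    let φ : S → EReal := fun s => (e ⟨s.1, hσ.1 s.2⟩ : EReal)
    have hφ : ∀ s t : S, φ s ≤ φ t ↔ s ≤ t := by
      intro s t
      change (e ⟨s.1, hσ.1 s.2⟩ : EReal) ≤ (e ⟨t.1, hσ.1 t.2⟩ : EReal) ↔ _
      rw [Subtype.coe_le_coe, e.le_iff_le]
      rfl
    have hinj : Function.Injective φ := fun s t hst =>
      le_antisymm ((hφ s t).1 hst.le) ((hφ t s).1 hst.ge)
    refine ⟨Set.range φ, ⟨?_⟩, ⟨⟨Equiv.ofInjective φ hinj, ?_⟩⟩⟩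
    · rintro _ ⟨s, rfl⟩ _ ⟨t, rfl⟩ c ⟨hc1, hc2⟩
      have hcI : c ∈ I := hI.out (e ⟨s.1, hσ.1 s.2⟩).2 (e ⟨t.1, hσ.1 t.2⟩).2 ⟨hc1, hc2⟩
      obtain ⟨ρ, hρ⟩ := e.surjective ⟨c, hcI⟩
      have h1 : s.1 ≤ ρ.1 := by
        have : e ⟨s.1, hσ.1 s.2⟩ ≤ e ρ := by rw [hρ]; exact hc1
        exact e.le_iff_le.1 this
      have h2 : ρ.1 ≤ t.1 := by
        have : e ρ ≤ e ⟨t.1, hσ.1 t.2⟩ := by rw [hρ]; exact hc2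
        exact e.le_iff_le.1 this
      refine ⟨⟨ρ.1, hconv s.1 s.2 t.1 t.2 ρ.1 h1 h2⟩, ?_⟩
      change (e ⟨ρ.1, _⟩ : EReal) = c
      have : (⟨ρ.1, hσ.1 (hconv s.1 s.2 t.1 t.2 ρ.1 h1 h2)⟩ : {μ : ValSpace R // μ ≤ σ}) = ρ :=
        Subtype.ext rfl
      rw [this, hρ]
    · intro s t
      exact hφ s t
  · intro S hS
    obtain ⟨s, hs⟩ := hS
    obtain ⟨x, y, Q, hx⟩ := hpar s
    obtain ⟨ρ, hρ⟩ := VTree.chain_sup hab (lowerBounds S) ⟨ν₀, fun μ _ => h₀ μ⟩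
      (fun μ hμ μ' hμ' _ => VTree.total Q (hμ hs) (hμ' hs) hx)
    exact ⟨ρ, fun μ hμ => hρ.2 fun κ hκ => hκ hμ, fun κ hκ => hρ.1 hκ⟩
  · intro c hc
    obtain ⟨σ, hσ⟩ := VTree.chain_sup hab (Set.range c) (Set.range_nonempty c) (by
      rintro _ ⟨i, rfl⟩ _ ⟨j, rfl⟩ _
      exact (le_total i j).imp (fun h => hc h) (fun h => hc h))
    exact ⟨σ, fun n => hσ.1 ⟨n, rfl⟩⟩
end
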